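/- arXiv:2003.12833 — 2 statements merged into one kernel-verified Lean document; each statement's English description precedes it below -/
import Mathlib

section
/- There exists an absolute constant c ≥ 1 such that for every convex body D ⊆ ℝ², every x ∈ D and every integer n ≥ 1: c⁻¹·λₙ(x,D) ≤ λ₂ₙ(x,D) ≤ c·λₙ(x,D). -/
open MeasureTheory Set Pointwise

noncomputable section

abbrev E (d : ℕ) := EuclideanSpace ℝ (Fin d)
abbrev E2 := EuclideanSpace ℝ (Fin 2)

/-- The Christoffel function `λ_n(x, D)` for Lebesgue measure on `D ⊆ ℝ^d`. -/
noncomputable def christoffel (d n : ℕ) (x : E d) (D : Set (E d)) : ℝ :=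
  sInf { r : ℝ | ∃ p : MvPolynomial (Fin d) ℝ, p.totalDegree ≤ n ∧
    MvPolynomial.eval (fun i => x i) p = 1 ∧
    r = ∫ y in D, (MvPolynomial.eval (fun i => y i) p) ^ 2 }

/-- Determinant of the linear part of an affine automorphism of `ℝ^d`. -/
noncomputable def adet {d : ℕ} (T : E d ≃ᵃ[ℝ] E d) : ℝ :=
  LinearMap.det (T.linear : E d →ₗ[ℝ] E d)

/-- The closed unit ball `B` of `ℝ²`. -/
def ballE : Set E2 := Metric.closedBall 0 1

/-- The unit square `S = [0,1]²` in `ℝ²`. -/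
def squareS : Set E2 := {y : E2 | y 0 ∈ Icc (0:ℝ) 1 ∧ y 1 ∈ Icc (0:ℝ) 1}

/-- The geometric quantity `L(x, D)`. -/
noncomputable def Lfun (x : E2) (D : Set E2) : ℝ :=
  sSup { r : ℝ | ∃ T : E2 ≃ᵃ[ℝ] E2, x ∈ T '' ballE ∧ T '' ballE ⊆ D ∧
    r = Real.sqrt (1 - ‖T.symm x‖) * |adet T| }

/-- The geometric quantity `U(x, D)`. -/
noncomputable def Ufun (x : E2) (D : Set E2) : ℝ :=
  sInf { r : ℝ | ∃ T : E2 ≃ᵃ[ℝ] E2, x ∈ T '' ((2:ℝ)⁻¹ • squareS) ∧ D ⊆ T '' squareS ∧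
    r = Real.sqrt ((T.symm x) 0 * (T.symm x) 1) * |adet T| }

/-- A convex body in `ℝ²`: a compact convex set with nonempty interior. -/
def IsConvexBody (D : Set E2) : Prop := Convex ℝ D ∧ IsCompact D ∧ (interior D).Nonempty

/-- The point `(a, b)` of `ℝ²`. -/
noncomputable def e2 (a b : ℝ) : E2 := (WithLp.equiv 2 (Fin 2 → ℝ)).symm ![a, b]

theorem abs_sin_nat_mul_le (k : ℕ) (θ : ℝ) : |Real.sin (k * θ)| ≤ k * |Real.sin θ| := by
  induction k with
  | zero => simp
  | succ k ih =>
    push_cast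
    rw [add_mul, one_mul, Real.sin_add]
    calc _ ≤ |Real.sin (k * θ) * Real.cos θ| + |Real.cos (k * θ) * Real.sin θ| := abs_add_le _ _
      _ ≤ |Real.sin (k * θ)| * 1 + 1 * |Real.sin θ| := by
        rw [abs_mul, abs_mul]
        gcongr
        · exact Real.abs_cos_le_one _
        · exact Real.abs_cos_le_one _
      _ ≤ _ := by linarith

theorem integral_sin_mul_sin_nat (j l : ℕ) :
    ∫ θ in (0:ℝ)..Real.pi, Real.sin (((j:ℝ) + 1) * θ) * Real.sin (((l:ℝ) + 1) * θ) =
      if j = l then Real.pi / 2 else 0 := by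
  have key : ∀ z : ℤ, ∫ θ in (0:ℝ)..Real.pi, Real.cos (z * θ) = if z = 0 then Real.pi else 0 := by
    intro z
    split_ifs with hz
    · simp [hz]
    · have hz' : (z:ℝ) ≠ 0 := by exact_mod_cast hz
      rw [intervalIntegral.integral_comp_mul_left (fun x => Real.cos x) hz']
      simp [Real.sin_int_mul_pi]
  have h : ∀ θ : ℝ, Real.sin (((j:ℝ) + 1) * θ) * Real.sin (((l:ℝ) + 1) * θ) =
      (Real.cos ((((j:ℤ) - l : ℤ):ℝ) * θ) - Real.cos ((((j:ℤ) + l + 2 : ℤ):ℝ) * θ)) / 2 := by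
    intro θ
    have e1 : (((j:ℤ) - l : ℤ):ℝ) * θ = ((j:ℝ) + 1) * θ - ((l:ℝ) + 1) * θ := by push_cast; ring
    have e2 : (((j:ℤ) + l + 2 : ℤ):ℝ) * θ = ((j:ℝ) + 1) * θ + ((l:ℝ) + 1) * θ := by push_cast; ring
    rw [e1, e2, Real.cos_sub, Real.cos_add]; ring
  simp_rw [h]
  rw [intervalIntegral.integral_div, intervalIntegral.integral_sub
    (Continuous.intervalIntegrable (by fun_prop) _ _)
    (Continuous.intervalIntegrable (by fun_prop) _ _), key, key]
  have h2 : ¬ ((j:ℤ) + l + 2 = 0) := by omega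
  by_cases hjl : j = l
  · simp [hjl, show ¬ ((l:ℤ) + l + 2 = 0) by omega]
  · simp [hjl, h2, show ¬ ((j:ℤ) - l = 0) by omega]

theorem exists_chebyshevU_expansion (N : ℕ) (r : Polynomial ℝ) (hr : r.degree < N) :
    ∃ b : ℕ → ℝ, r = ∑ j ∈ Finset.range N,
      Polynomial.C (b j) * Polynomial.Chebyshev.U ℝ (j : ℤ) := by
  induction N generalizing r with
  | zero =>
    refine ⟨0, ?_⟩
    rw [Polynomial.degree_lt_iff_coeff_zero] at hr
    ext n; simp [hr n (Nat.zero_le n)]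
  | succ N ih =>
    set c := r.coeff N / 2 ^ N with hc
    have hU := Polynomial.Chebyshev.leadingCoeff_U_natCast ℝ N
    have hd := Polynomial.Chebyshev.natDegree_U_natCast ℝ N
    rw [Polynomial.leadingCoeff, hd] at hU
    obtain ⟨b, hb⟩ := ih (r - Polynomial.C c * Polynomial.Chebyshev.U ℝ (N : ℤ)) (by
      rw [Polynomial.degree_lt_iff_coeff_zero] at hr ⊢
      intro n hn
      rw [Polynomial.coeff_sub, Polynomial.coeff_C_mul]
      rcases hn.lt_or_eq with h | h
      · rw [hr n h, Polynomial.coeff_eq_zero_of_natDegree_lt (by rw [hd]; exact h)]; simp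
      · rw [← h, hU, hc]; field_simp; ring)
    refine ⟨Function.update b N c, ?_⟩
    rw [Finset.sum_range_succ, Function.update_self, ← sub_eq_iff_eq_add, hb]
    refine Finset.sum_congr rfl fun j hj => ?_
    rw [Function.update_of_ne (by simp at hj; omega)]

theorem integral_comp_cos_mul_sin {f : ℝ → ℝ} (hf : Continuous f) :
    ∫ θ in (0:ℝ)..Real.pi, f (Real.cos θ) * Real.sin θ = ∫ x in (-1:ℝ)..1, f x := by
  have h := intervalIntegral.integral_comp_mul_deriv (a := 0) (b := Real.pi)
    (f := Real.cos) (f' := fun x => - Real.sin x) (g := f)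
    (fun x _ => Real.hasDerivAt_cos x) (by fun_prop) hf
  simp only [Function.comp, mul_neg, intervalIntegral.integral_neg, Real.cos_zero, Real.cos_pi] at h
  rw [intervalIntegral.integral_symm (-1) 1] at h
  linarith

theorem sq_eval_mul_chebyshevU_le (p : Polynomial ℝ) (m k : ℕ) (hp : p.natDegree ≤ m) (x : ℝ) :
    (p.eval x * (Polynomial.Chebyshev.U ℝ (k : ℤ)).eval x) ^ 2 ≤
      2 / Real.pi * (k + 1) * (∑ j ∈ Finset.range (m + k + 1),
        (Polynomial.Chebyshev.U ℝ (j : ℤ)).eval x ^ 2) * ∫ y in (-1:ℝ)..1, p.eval y ^ 2 := by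
  obtain ⟨b, hb⟩ := exists_chebyshevU_expansion (m + k + 1)
    (p * Polynomial.Chebyshev.U ℝ (k : ℤ)) (by
      refine lt_of_le_of_lt (Polynomial.degree_mul_le _ _) ?_
      rw [Polynomial.Chebyshev.degree_U_natCast]
      calc p.degree + (k : WithBot ℕ) ≤ (m : WithBot ℕ) + k := by
            gcongr; exact Polynomial.degree_le_of_natDegree_le hp
        _ < ((m + k + 1 : ℕ) : WithBot ℕ) := by
            rw [← Nat.cast_add, Nat.cast_lt]; omega)
  set N := m + k + 1
  have hpi := Real.pi_pos
  have hsin : ∀ θ : ℝ, p.eval (Real.cos θ) * Real.sin (((k:ℝ) + 1) * θ) =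
      ∑ j ∈ Finset.range N, b j * Real.sin (((j:ℝ) + 1) * θ) := by
    intro θ
    have := congrArg (fun q => q.eval (Real.cos θ) * Real.sin θ) hb
    simp only [Polynomial.eval_mul, Polynomial.eval_finsetSum, Polynomial.eval_C, Finset.sum_mul,
      mul_assoc, Polynomial.Chebyshev.U_real_cos] at this
    simpa using this
  have hpars : ∫ θ in (0:ℝ)..Real.pi, (p.eval (Real.cos θ) * Real.sin (((k:ℝ) + 1) * θ)) ^ 2 =
      Real.pi / 2 * ∑ j ∈ Finset.range N, b j ^ 2 := by
    simp_rw [hsin, sq, Finset.sum_mul_sum]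
    rw [intervalIntegral.integral_finsetSum
      (fun i _ => Continuous.intervalIntegrable (by fun_prop) _ _), Finset.mul_sum]
    refine Finset.sum_congr rfl fun i hi => ?_
    rw [intervalIntegral.integral_finsetSum
      (fun i _ => Continuous.intervalIntegrable (by fun_prop) _ _)]
    have : ∀ j, ∫ θ in (0:ℝ)..Real.pi, b i * Real.sin (((i:ℝ) + 1) * θ) *
        (b j * Real.sin (((j:ℝ) + 1) * θ)) = if i = j then b i * b j * (Real.pi / 2) else 0 := by
      intro j
      have e : ∀ θ : ℝ, b i * Real.sin (((i:ℝ) + 1) * θ) * (b j * Real.sin (((j:ℝ) + 1) * θ)) =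
        b i * b j * (Real.sin (((i:ℝ) + 1) * θ) * Real.sin (((j:ℝ) + 1) * θ)) := fun θ => by ring
      simp_rw [e]
      rw [intervalIntegral.integral_const_mul, integral_sin_mul_sin_nat]
      simp
    simp_rw [this]
    rw [Finset.sum_ite_eq, if_pos hi]; ring
  have hle : ∫ θ in (0:ℝ)..Real.pi, (p.eval (Real.cos θ) * Real.sin (((k:ℝ) + 1) * θ)) ^ 2 ≤
      (k + 1) * ∫ y in (-1:ℝ)..1, p.eval y ^ 2 := by
    rw [← integral_comp_cos_mul_sin (f := fun y => p.eval y ^ 2) (by fun_prop),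
      ← intervalIntegral.integral_const_mul]
    refine intervalIntegral.integral_mono_on hpi.le
      (Continuous.intervalIntegrable (by fun_prop) _ _)
      (Continuous.intervalIntegrable (by fun_prop) _ _) fun θ hθ => ?_
    have h0 := Real.sin_nonneg_of_mem_Icc hθ
    have h1 := abs_sin_nat_mul_le (k + 1) θ
    push_cast at h1
    rw [abs_of_nonneg h0] at h1
    have h2 := Real.abs_sin_le_one (((k:ℝ) + 1) * θ)
    have h3 : Real.sin (((k:ℝ) + 1) * θ) ^ 2 ≤ (k + 1) * Real.sin θ := by
      rw [← sq_abs, sq]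
      nlinarith [abs_nonneg (Real.sin (((k:ℝ) + 1) * θ))]
    rw [mul_pow]
    nlinarith [sq_nonneg (p.eval (Real.cos θ))]
  have hcs : (p.eval x * (Polynomial.Chebyshev.U ℝ (k : ℤ)).eval x) ^ 2 ≤
      (∑ j ∈ Finset.range N, b j ^ 2) *
        ∑ j ∈ Finset.range N, (Polynomial.Chebyshev.U ℝ (j : ℤ)).eval x ^ 2 := by
    rw [← Polynomial.eval_mul, hb, Polynomial.eval_finsetSum]
    simp only [Polynomial.eval_mul, Polynomial.eval_C]
    exact Finset.sum_mul_sq_le_sq_mul_sq _ _ _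
  have hb2 : ∑ j ∈ Finset.range N, b j ^ 2 ≤
      2 / Real.pi * ((k + 1) * ∫ y in (-1:ℝ)..1, p.eval y ^ 2) := by
    rw [hpars] at hle
    calc _ = 2 / Real.pi * (Real.pi / 2 * ∑ j ∈ Finset.range N, b j ^ 2) := by field_simp
      _ ≤ _ := by gcongr
  refine hcs.trans ((mul_le_mul_of_nonneg_right hb2
    (Finset.sum_nonneg fun _ _ => sq_nonneg _)).trans_eq (by ring))

theorem chebyshevU_near_one {m : ℕ} (hm : 1 ≤ m) {x : ℝ} (hx : |x - 1| ≤ 1 / (32 * (m:ℝ) ^ 2))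
    (j : ℕ) (hj : j + 1 ≤ 2 * m) :
    |(Polynomial.Chebyshev.U ℝ (j : ℤ)).eval x - (Polynomial.Chebyshev.U ℝ ((j : ℤ) - 1)).eval x
      - 1| ≤ j / (4 * m) ∧ ((j:ℝ) + 1) / 2 ≤ (Polynomial.Chebyshev.U ℝ (j : ℤ)).eval x ∧
      (Polynomial.Chebyshev.U ℝ (j : ℤ)).eval x ≤ 2 * (j + 1) := by
  have hm0 : (1:ℝ) ≤ m := by exact_mod_cast hm
  induction j with
  | zero => norm_num
  | succ j ih =>
    obtain ⟨h1, h2, h3⟩ := ih (by omega)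
    have hj' : (j:ℝ) + 2 ≤ 2 * m := by exact_mod_cast hj
    have hrec : (Polynomial.Chebyshev.U ℝ ((j + 1 : ℕ) : ℤ)).eval x =
        2 * x * (Polynomial.Chebyshev.U ℝ (j : ℤ)).eval x -
          (Polynomial.Chebyshev.U ℝ ((j : ℤ) - 1)).eval x := by
      have := congrArg (Polynomial.eval x) (Polynomial.Chebyshev.U_add_one ℝ (j : ℤ))
      simpa using this
    have hcast : (((j + 1 : ℕ) : ℤ) - 1) = (j : ℤ) := by push_cast; ring
    rw [hcast, hrec]
    set a := (Polynomial.Chebyshev.U ℝ (j : ℤ)).eval x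
    set b := (Polynomial.Chebyshev.U ℝ ((j : ℤ) - 1)).eval x
    have hstep : |2 * (x - 1) * a| ≤ 1 / (4 * m) := by
      rw [abs_mul, abs_mul, abs_two, abs_of_nonneg (by linarith : (0:ℝ) ≤ a)]
      calc 2 * |x - 1| * a ≤ 2 * (1 / (32 * (m:ℝ) ^ 2)) * (2 * (2 * m)) := by
            gcongr
            all_goals linarith
        _ = 1 / (4 * m) := by field_simp; norm_num
    have hd : |2 * x * a - b - a - 1| ≤ ((j + 1 : ℕ):ℝ) / (4 * m) := by
      calc |2 * x * a - b - a - 1| = |2 * (x - 1) * a + (a - b - 1)| := by congr 1; ring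
        _ ≤ 1 / (4 * m) + j / (4 * m) := (abs_add_le _ _).trans (add_le_add hstep h1)
        _ = _ := by push_cast; ring
    have hd2 : ((j + 1 : ℕ):ℝ) / (4 * m) ≤ 1 / 2 := by
      rw [div_le_iff₀ (by positivity)]; push_cast; linarith
    refine ⟨hd, ?_, ?_⟩
    · have := (abs_le.mp (hd.trans hd2)).1
      push_cast; linarith
    · have := (abs_le.mp (hd.trans hd2)).2
      push_cast; linarith

theorem exists_nat_sin_sq_ge {θ : ℝ} (h0 : 0 < θ) (h1 : θ < Real.pi) :
    ∃ k : ℕ, 1 ≤ k ∧ 1 / 2 ≤ Real.sin (k * θ) ^ 2 ∧ k * Real.sin θ ≤ 3 := by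
  have main : ∀ φ : ℝ, 0 < φ → φ ≤ Real.pi / 2 →
      ∃ k : ℕ, 1 ≤ k ∧ 1 / 2 ≤ Real.sin (k * φ) ^ 2 ∧ k * Real.sin φ ≤ 3 := by
    intro φ hφ hφ2
    have hpi := Real.pi_lt_d2
    have hpi0 := Real.pi_pos
    have hq : 0 < Real.pi / (4 * φ) := by positivity
    refine ⟨⌈Real.pi / (4 * φ)⌉₊, Nat.one_le_ceil_iff.mpr hq, ?_, ?_⟩
    all_goals
      have hl := Nat.le_ceil (Real.pi / (4 * φ))
      have hu := Nat.ceil_lt_add_one hq.le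
      set k : ℝ := (⌈Real.pi / (4 * φ)⌉₊ : ℝ)
      have hl' : Real.pi / 4 ≤ k * φ := by
        have := mul_le_mul_of_nonneg_right hl hφ.le
        have e : Real.pi / (4 * φ) * φ = Real.pi / 4 := by field_simp
        linarith
      have hu' : k * φ ≤ 3 * Real.pi / 4 := by
        have := mul_le_mul_of_nonneg_right hu.le hφ.le
        have e : (Real.pi / (4 * φ) + 1) * φ = Real.pi / 4 + φ := by field_simp
        linarith
    · have hc : Real.cos (2 * (k * φ)) ≤ 0 :=
        Real.cos_nonpos_of_pi_div_two_le_of_le (by linarith) (by linarith)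
      rw [Real.cos_two_mul] at hc
      have := Real.sin_sq_add_cos_sq (k * φ)
      linarith
    · have hk : 0 ≤ k := Nat.cast_nonneg _
      have := mul_le_mul_of_nonneg_left (Real.sin_le hφ.le) hk
      linarith
  rcases le_total θ (Real.pi / 2) with h | h
  · exact main θ h0 h
  · obtain ⟨k, hk, hs, hb⟩ := main (Real.pi - θ) (by linarith) (by linarith)
    refine ⟨k, hk, ?_, by rwa [Real.sin_pi_sub] at hb⟩
    have e : (k:ℝ) * (Real.pi - θ) = k * Real.pi - k * θ := by ring
    rw [e, Real.sin_sub, Real.sin_nat_mul_pi, zero_mul, zero_sub, neg_sq, mul_pow] at hs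
    have hc := Real.cos_sq_le_one (k * Real.pi)
    nlinarith [sq_nonneg (Real.sin (k * θ))]

theorem sq_eval_le_near_one (p : Polynomial ℝ) {m : ℕ} (hm : 1 ≤ m) (hp : p.natDegree ≤ m) {x : ℝ}
    (hx : |x - 1| ≤ 1 / (32 * (m:ℝ) ^ 2)) :
    p.eval x ^ 2 ≤ 128 * (m:ℝ) ^ 2 * ∫ y in (-1:ℝ)..1, p.eval y ^ 2 := by
  have hm0 : (1:ℝ) ≤ m := by exact_mod_cast hm
  obtain ⟨k, rfl⟩ : ∃ k, m = k + 1 := ⟨m - 1, by omega⟩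
  have h := sq_eval_mul_chebyshevU_le p (k + 1) k hp x
  have hI : 0 ≤ ∫ y in (-1:ℝ)..1, p.eval y ^ 2 :=
    intervalIntegral.integral_nonneg (by norm_num) fun _ _ => sq_nonneg _
  set I := ∫ y in (-1:ℝ)..1, p.eval y ^ 2
  have hS : ∑ j ∈ Finset.range (k + 1 + k + 1), (Polynomial.Chebyshev.U ℝ (j : ℤ)).eval x ^ 2 ≤
      32 * ((k + 1 : ℕ):ℝ) ^ 3 := by
    calc _ ≤ ∑ j ∈ Finset.range (k + 1 + k + 1), (4 * ((k + 1 : ℕ):ℝ)) ^ 2 := by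
          refine Finset.sum_le_sum fun j hj => ?_
          have hj' : j + 1 ≤ 2 * (k + 1) := by simp at hj; omega
          obtain ⟨-, h2, h3⟩ := chebyshevU_near_one hm hx j hj'
          have : ((j:ℝ) + 1) ≤ 2 * ((k + 1 : ℕ):ℝ) := by exact_mod_cast hj'
          have hj0 : (0:ℝ) ≤ j := Nat.cast_nonneg _
          gcongr <;> linarith
      _ = _ := by
        rw [Finset.sum_const, Finset.card_range, nsmul_eq_mul]; push_cast; ring
  obtain ⟨-, hU, -⟩ := chebyshevU_near_one hm hx k (by omega)
  have hpi : 2 / Real.pi ≤ 1 := by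
    rw [div_le_one Real.pi_pos]; exact Real.two_le_pi
  rw [mul_pow] at h
  push_cast at *
  set M : ℝ := (k:ℝ) + 1
  have hU2 : (M / 2) ^ 2 ≤ ((Polynomial.Chebyshev.U ℝ (k : ℤ)).eval x) ^ 2 := by gcongr
  have h2 : p.eval x ^ 2 * (M / 2) ^ 2 ≤ 1 * M * (32 * M ^ 3) * I := by
    calc _ ≤ _ := mul_le_mul_of_nonneg_left hU2 (sq_nonneg _)
      _ ≤ _ := h
      _ ≤ _ := by
        gcongr
  have hM2 : 0 < (M / 2) ^ 2 := by positivity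
  refine le_of_mul_le_mul_right (h2.trans_eq ?_) hM2
  ring

theorem sq_eval_le_interior (p : Polynomial ℝ) {m : ℕ} (hm : 1 ≤ m) (hp : p.natDegree ≤ m)
    {θ : ℝ} (h0 : 0 < θ) (h1 : θ < Real.pi) (hθ : 1 ≤ 12 * m * Real.sin θ) :
    p.eval (Real.cos θ) ^ 2 * Real.sin θ ≤
      222 * m * ∫ y in (-1:ℝ)..1, p.eval y ^ 2 := by
  have hm0 : (1:ℝ) ≤ m := by exact_mod_cast hm
  have hs : 0 < Real.sin θ := Real.sin_pos_of_pos_of_lt_pi h0 h1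
  obtain ⟨k, hk, hk2, hk3⟩ := exists_nat_sin_sq_ge h0 h1
  obtain ⟨k, rfl⟩ : ∃ l, k = l + 1 := ⟨k - 1, by omega⟩
  have h := sq_eval_mul_chebyshevU_le p m k hp (Real.cos θ)
  have hI : 0 ≤ ∫ y in (-1:ℝ)..1, p.eval y ^ 2 :=
    intervalIntegral.integral_nonneg (by norm_num) fun _ _ => sq_nonneg _
  set I := ∫ y in (-1:ℝ)..1, p.eval y ^ 2
  set s := Real.sin θ
  have hS : (∑ j ∈ Finset.range (m + k + 1),
      (Polynomial.Chebyshev.U ℝ (j : ℤ)).eval (Real.cos θ) ^ 2) * s ^ 2 ≤ m + k + 1 := by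
    rw [Finset.sum_mul]
    calc _ ≤ ∑ j ∈ Finset.range (m + k + 1), (1:ℝ) := by
          refine Finset.sum_le_sum fun j hj => ?_
          rw [← mul_pow, Polynomial.Chebyshev.U_real_cos]
          exact Real.sin_sq_le_one _
      _ = _ := by simp
  set S := ∑ j ∈ Finset.range (m + k + 1),
      (Polynomial.Chebyshev.U ℝ (j : ℤ)).eval (Real.cos θ) ^ 2
  have hU := Polynomial.Chebyshev.U_real_cos θ (k : ℤ)
  rw [Int.cast_natCast] at hU
  push_cast at h hk2 hk3
  have hpi : 2 / Real.pi ≤ 1 := by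
    rw [div_le_one Real.pi_pos]; exact Real.two_le_pi
  have hk4 : (k:ℝ) + 1 ≤ 36 * m := by
    have : 0 ≤ (k:ℝ) + 1 := by positivity
    nlinarith
  have e : p.eval (Real.cos θ) ^ 2 * Real.sin (((k:ℝ) + 1) * θ) ^ 2 =
      (p.eval (Real.cos θ) * (Polynomial.Chebyshev.U ℝ (k : ℤ)).eval (Real.cos θ)) ^ 2 * s ^ 2 := by
    rw [← hU]; ring
  have h3 : p.eval (Real.cos θ) ^ 2 * (1 / 2) ≤ (k + 1) * (37 * m) * I := by
    calc _ ≤ p.eval (Real.cos θ) ^ 2 * Real.sin (((k:ℝ) + 1) * θ) ^ 2 := by gcongr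
      _ ≤ (2 / Real.pi * (k + 1) * S * I) * s ^ 2 := by rw [e]; gcongr
      _ = (2 / Real.pi) * ((k + 1) * (S * s ^ 2) * I) := by ring
      _ ≤ 1 * ((k + 1) * (m + k + 1) * I) := by gcongr
      _ ≤ _ := by rw [one_mul]; gcongr; linarith
  calc _ = 2 * (p.eval (Real.cos θ) ^ 2 * (1 / 2)) * s := by ring
    _ ≤ 2 * ((k + 1) * (37 * m) * I) * s := by gcongr
    _ = 2 * (37 * m) * I * ((k + 1) * s) := by ring
    _ ≤ 2 * (37 * m) * I * 3 := by gcongr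
    _ = _ := by ring

/-- Lower bound for the Christoffel function of `[0, 1]`, valid slightly beyond the left endpoint. -/
theorem sq_eval_mul_sqrt_le (p : Polynomial ℝ) {m : ℕ} (hm : 1 ≤ m) (hp : p.natDegree ≤ m)
    {y w : ℝ} (hy0 : -(1 / (64 * (m:ℝ) ^ 2)) ≤ y) (hy1 : y ≤ 8 / 9) (hw : w ≤ y + 2 / (m:ℝ) ^ 2) :
    p.eval y ^ 2 * √w ≤ 10000 * m * ∫ t in (0:ℝ)..1, p.eval t ^ 2 := by
  have hm0 : (1:ℝ) ≤ m := by exact_mod_cast hm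
  set P := p.comp (Polynomial.C (1/2) - Polynomial.C (1/2) * Polynomial.X) with hPdef
  have hP : P.natDegree ≤ m := by
    refine Polynomial.natDegree_comp_le.trans ?_
    refine (Nat.mul_le_mul hp (?_ : _ ≤ 1)).trans_eq (mul_one m)
    compute_degree
  have hev : ∀ x, P.eval x = p.eval ((1 - x) / 2) := by
    intro x; rw [hPdef, Polynomial.eval_comp]; congr 1; simp; ring
  have h_int : ∫ x in (-1:ℝ)..1, P.eval x ^ 2 = 2 * ∫ t in (0:ℝ)..1, p.eval t ^ 2 := by
    simp_rw [hev]
    have := intervalIntegral.integral_comp_sub_mul (a := -1) (b := 1)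
      (fun t => p.eval t ^ 2) (c := 1/2) (by norm_num) (1/2)
    have e : ∀ x : ℝ, (1 - x) / 2 = 1/2 - 1/2 * x := fun x => by ring
    simp_rw [e]
    rw [this]; norm_num
  have hI : 0 ≤ ∫ t in (0:ℝ)..1, p.eval t ^ 2 :=
    intervalIntegral.integral_nonneg (by norm_num) fun _ _ => sq_nonneg _
  set I := ∫ t in (0:ℝ)..1, p.eval t ^ 2
  have hyx : P.eval (1 - 2 * y) = p.eval y := by rw [hev]; congr 1; ring
  rw [← hyx]
  rcases le_or_gt y (1 / (64 * (m:ℝ) ^ 2)) with hy | hy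
  · have h := sq_eval_le_near_one P hm hP (x := 1 - 2 * y) (by
      rw [show 1 - 2 * y - 1 = -(2 * y) by ring, abs_neg, abs_mul, abs_two]
      have := abs_le.mpr ⟨hy0, hy⟩
      calc 2 * |y| ≤ 2 * (1 / (64 * (m:ℝ) ^ 2)) := by gcongr
        _ = _ := by field_simp; norm_num)
    rw [h_int] at h
    have hsw : √w ≤ 2 / m := by
      apply Real.sqrt_le_iff.mpr ⟨by positivity, ?_⟩
      have e1 : 1 / (64 * (m:ℝ) ^ 2) = (1/64) / (m:ℝ)^2 := by field_simp
      rw [e1] at hy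
      calc w ≤ (1/64) / (m:ℝ)^2 + 2 / (m:ℝ) ^ 2 := by linarith
        _ ≤ (4:ℝ) / (m:ℝ)^2 := by rw [← add_div]; gcongr; norm_num
        _ = _ := by rw [div_pow]; norm_num
    calc _ ≤ (128 * (m:ℝ) ^ 2 * (2 * I)) * (2 / m) := by gcongr
      _ = 512 * m * I := by field_simp; ring
      _ ≤ _ := by gcongr; norm_num
  · have hypos : 0 < y := lt_of_le_of_lt (by positivity) hy
    have hcos : Real.cos (Real.arccos (1 - 2 * y)) = 1 - 2 * y :=
      Real.cos_arccos (by linarith) (by linarith)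
    have hsin : Real.sin (Real.arccos (1 - 2 * y)) = 2 * √(y * (1 - y)) := by
      rw [Real.sin_arccos, show 1 - (1 - 2 * y) ^ 2 = 2 ^ 2 * (y * (1 - y)) by ring,
        Real.sqrt_mul (by positivity), Real.sqrt_sq (by norm_num)]
    have hsy : 2 / 3 * √y ≤ Real.sin (Real.arccos (1 - 2 * y)) := by
      rw [hsin, show (2:ℝ) / 3 * √y = 2 * (√((1/3)^2) * √y) by
        rw [Real.sqrt_sq (by norm_num)]; ring, ← Real.sqrt_mul (by positivity)]
      refine mul_le_mul_of_nonneg_left (Real.sqrt_le_sqrt ?_) (by norm_num)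
      nlinarith
    have hmy : 1 ≤ 8 * m * √y := by
      have h8 : 1 / (8 * (m:ℝ)) ≤ √y := by
        apply Real.le_sqrt_of_sq_le
        calc (1 / (8 * (m:ℝ))) ^ 2 = 1 / (64 * (m:ℝ) ^ 2) := by field_simp; norm_num
          _ ≤ y := hy.le
      rw [div_le_iff₀ (by positivity)] at h8
      linarith
    have h1m : 2 / (m:ℝ) ^ 2 ≤ 128 * y := by
      calc 2 / (m:ℝ) ^ 2 = 128 * (1 / (64 * (m:ℝ) ^ 2)) := by field_simp; norm_num
        _ ≤ 128 * y := by gcongr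
    have hsw : √w ≤ 12 * √y := by
      rw [show (12:ℝ) = √(12 ^ 2) by rw [Real.sqrt_sq (by norm_num)], ← Real.sqrt_mul (by positivity)]
      gcongr; linarith
    have h := sq_eval_le_interior P hm hP (θ := Real.arccos (1 - 2 * y))
      (Real.arccos_pos.mpr (by linarith)) ?_ ?_
    · rw [hcos, h_int] at h
      calc P.eval (1 - 2 * y) ^ 2 * √w ≤ P.eval (1 - 2 * y) ^ 2 * (12 * √y) := by gcongr
        _ = 18 * (P.eval (1 - 2 * y) ^ 2 * (2 / 3 * √y)) := by ring
        _ ≤ 18 * (222 * m * (2 * I)) := by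
          have := (mul_le_mul_of_nonneg_left hsy (sq_nonneg _)).trans h
          linarith
        _ = 7992 * m * I := by ring
        _ ≤ _ := by gcongr; norm_num
    · refine lt_of_le_of_ne (Real.arccos_le_pi _) fun h => ?_
      rw [Real.arccos_eq_pi] at h; linarith
    · have : (m:ℝ) * (2 / 3 * √y) ≤ m * Real.sin (Real.arccos (1 - 2 * y)) := by gcongr
      linarith

theorem fejer_kernel_eq (m : ℕ) (u : ℝ) :
    ∑ j ∈ Finset.range m, ∑ l ∈ Finset.range m, Real.cos (((j:ℝ) - l) * u) =
      ‖∑ j ∈ Finset.range m, Complex.exp (Complex.I * u) ^ j‖ ^ 2 := by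
  have hj : ∀ j : ℕ, Complex.exp (Complex.I * u) ^ j =
      (Real.cos (j * u) : ℂ) + (Real.sin (j * u) : ℂ) * Complex.I := by
    intro j
    rw [← Complex.exp_nat_mul, show (j:ℂ) * (Complex.I * u) = ((j * u : ℝ) : ℂ) * Complex.I by
      push_cast; ring, Complex.exp_mul_I, Complex.ofReal_cos, Complex.ofReal_sin]
  simp_rw [hj, Finset.sum_add_distrib, ← Finset.sum_mul, ← Complex.ofReal_sum]
  rw [← Complex.normSq_eq_norm_sq, Complex.normSq_add_mul_I, sq, sq, Finset.sum_mul_sum,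
    Finset.sum_mul_sum, ← Finset.sum_add_distrib]
  refine Finset.sum_congr rfl fun j _ => ?_
  rw [← Finset.sum_add_distrib]
  refine Finset.sum_congr rfl fun l _ => ?_
  rw [sub_mul, Real.cos_sub]

theorem norm_sum_exp_le (m : ℕ) (u : ℝ) :
    ‖∑ j ∈ Finset.range m, Complex.exp (Complex.I * u) ^ j‖ ≤ m := by
  refine (norm_sum_le _ _).trans_eq ?_
  have : ∀ j : ℕ, ‖Complex.exp (Complex.I * u) ^ j‖ = 1 := by
    intro j; rw [norm_pow, mul_comm, Complex.norm_exp_ofReal_mul_I, one_pow]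
  simp [this]

theorem norm_sum_exp_mul_sin_le (m : ℕ) (u : ℝ) :
    ‖∑ j ∈ Finset.range m, Complex.exp (Complex.I * u) ^ j‖ * |Real.sin (u / 2)| ≤ 1 := by
  have h1 : ‖Complex.exp (Complex.I * u)‖ = 1 := by
    rw [mul_comm, Complex.norm_exp_ofReal_mul_I]
  have h2 := Complex.norm_exp_I_mul_ofReal_sub_one u
  have h3 := congrArg norm (geom_sum_mul (Complex.exp (Complex.I * u)) m)
  rw [norm_mul, h2, Real.norm_eq_abs, abs_mul, abs_two] at h3
  have h4 : ‖Complex.exp (Complex.I * u) ^ m - 1‖ ≤ 2 := by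
    refine (norm_sub_le _ _).trans ?_
    rw [norm_pow, h1]; norm_num
  linarith

/-- The normalised Fejér kernel, symmetrised to an algebraic polynomial in `cos θ`. -/
def fejerPoly (m : ℕ) (θ₀ : ℝ) : Polynomial ℝ :=
  ∑ j ∈ Finset.range m, ∑ l ∈ Finset.range m,
    Polynomial.C (2 * Real.cos (((j:ℝ) - l) * θ₀) / m ^ 2) * Polynomial.Chebyshev.T ℝ ((j:ℤ) - l)

theorem natDegree_fejerPoly_le (m : ℕ) (θ₀ : ℝ) : (fejerPoly m θ₀).natDegree ≤ m - 1 := by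
  refine Polynomial.natDegree_sum_le_of_forall_le _ _ fun j hj => ?_
  refine Polynomial.natDegree_sum_le_of_forall_le _ _ fun l hl => ?_
  refine (Polynomial.natDegree_C_mul_le _ _).trans ?_
  rw [Polynomial.Chebyshev.natDegree_T]
  simp at hj hl
  omega

theorem eval_fejerPoly_cos (m : ℕ) (θ₀ θ : ℝ) : (fejerPoly m θ₀).eval (Real.cos θ) =
    (‖∑ j ∈ Finset.range m, Complex.exp (Complex.I * ((θ - θ₀ : ℝ) : ℂ)) ^ j‖ ^ 2 +
     ‖∑ j ∈ Finset.range m, Complex.exp (Complex.I * ((θ + θ₀ : ℝ) : ℂ)) ^ j‖ ^ 2) / m ^ 2 := by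
  rw [← fejer_kernel_eq, ← fejer_kernel_eq, fejerPoly, Polynomial.eval_finsetSum,
    ← Finset.sum_add_distrib, Finset.sum_div]
  refine Finset.sum_congr rfl fun j _ => ?_
  rw [Polynomial.eval_finsetSum, ← Finset.sum_add_distrib, Finset.sum_div]
  refine Finset.sum_congr rfl fun l _ => ?_
  rw [Polynomial.eval_mul, Polynomial.eval_C, Polynomial.Chebyshev.T_real_cos, mul_sub, mul_add,
    Real.cos_sub, Real.cos_add]
  push_cast
  ring

theorem one_le_eval_fejerPoly {m : ℕ} (hm : 1 ≤ m) (θ₀ : ℝ) :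
    1 ≤ (fejerPoly m θ₀).eval (Real.cos θ₀) := by
  have hm0 : (1:ℝ) ≤ m := by exact_mod_cast hm
  rw [eval_fejerPoly_cos, one_le_div (by positivity)]
  simp only [sub_self, Complex.ofReal_zero, mul_zero, Complex.exp_zero, one_pow, Finset.sum_const,
    Finset.card_range, nsmul_eq_mul, mul_one, Complex.norm_natCast]
  exact le_add_of_nonneg_right (sq_nonneg _)

theorem abs_sin_half_sub_le_sin_half_add {θ θ₀ : ℝ} (h : θ ∈ Icc 0 Real.pi)
    (h₀ : θ₀ ∈ Icc 0 Real.pi) : |Real.sin ((θ - θ₀) / 2)| ≤ |Real.sin ((θ + θ₀) / 2)| := by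
  have a1 : 0 ≤ Real.sin (θ / 2) := Real.sin_nonneg_of_nonneg_of_le_pi (by linarith [h.1])
    (by linarith [h.2, Real.pi_pos])
  have a2 : 0 ≤ Real.sin (θ₀ / 2) := Real.sin_nonneg_of_nonneg_of_le_pi (by linarith [h₀.1])
    (by linarith [h₀.2, Real.pi_pos])
  have b1 : 0 ≤ Real.cos (θ / 2) := Real.cos_nonneg_of_mem_Icc
    ⟨by linarith [h.1, Real.pi_pos], by linarith [h.2]⟩
  have b2 : 0 ≤ Real.cos (θ₀ / 2) := Real.cos_nonneg_of_mem_Icc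
    ⟨by linarith [h₀.1, Real.pi_pos], by linarith [h₀.2]⟩
  rw [sub_div, add_div, Real.sin_sub, Real.sin_add]
  have := mul_nonneg a1 b2
  have := mul_nonneg b1 a2
  rw [abs_of_nonneg (a := _ + _) (by positivity), abs_le]
  constructor <;> linarith

theorem abs_div_pi_le_abs_sin_half {v : ℝ} (hv : |v| ≤ Real.pi) :
    |v| / Real.pi ≤ |Real.sin (v / 2)| := by
  have h := Real.mul_abs_le_abs_sin (x := v / 2) (by rw [abs_div, abs_two]; linarith)
  rw [abs_div, abs_two] at h
  calc |v| / Real.pi = 2 / Real.pi * (|v| / 2) := by ring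
    _ ≤ _ := h

theorem eval_fejerPoly_sq_le {m : ℕ} (hm : 1 ≤ m) {θ θ₀ : ℝ} (h : θ ∈ Icc 0 Real.pi)
    (h₀ : θ₀ ∈ Icc 0 Real.pi) :
    (fejerPoly m θ₀).eval (Real.cos θ) ^ 2 ≤
      16 / (1 + (m / Real.pi * (θ - θ₀)) ^ 2) ^ 2 := by
  have hm0 : (1:ℝ) ≤ m := by exact_mod_cast hm
  have hpi := Real.pi_pos
  have hv : |θ - θ₀| ≤ Real.pi := abs_le.mpr ⟨by linarith [h.1, h₀.2], by linarith [h.2, h₀.1]⟩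
  have hs := abs_div_pi_le_abs_sin_half hv
  have gen : ∀ u : ℝ, |Real.sin ((θ - θ₀) / 2)| ≤ |Real.sin (u / 2)| →
      ‖∑ j ∈ Finset.range m, Complex.exp (Complex.I * (u : ℂ)) ^ j‖ ^ 2 / m ^ 2 ≤
        2 / (1 + (m / Real.pi * (θ - θ₀)) ^ 2) := by
    intro u hu
    have h1 := norm_sum_exp_le m u
    have h2 := norm_sum_exp_mul_sin_le m u
    set A := ‖∑ j ∈ Finset.range m, Complex.exp (Complex.I * (u : ℂ)) ^ j‖
    have hA : 0 ≤ A := norm_nonneg _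
    have h3 : A * (|θ - θ₀| / Real.pi) ≤ 1 :=
      (mul_le_mul_of_nonneg_left (hs.trans hu) hA).trans h2
    have h4 : (A * (|θ - θ₀| / Real.pi)) ^ 2 ≤ 1 := pow_le_one₀ (by positivity) h3
    have h5 : A ^ 2 ≤ (m:ℝ) ^ 2 := by gcongr
    rw [div_le_div_iff₀ (by positivity) (by positivity)]
    have e : A ^ 2 * (1 + (m / Real.pi * (θ - θ₀)) ^ 2) =
      A ^ 2 + m ^ 2 * (A * (|θ - θ₀| / Real.pi)) ^ 2 := by
      rw [mul_pow A, div_pow, sq_abs]; ring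
    rw [e]
    nlinarith
  rw [eval_fejerPoly_cos, add_div]
  have g1 := gen (θ - θ₀) le_rfl
  have g2 := gen (θ + θ₀) (abs_sin_half_sub_le_sin_half_add h h₀)
  calc _ ≤ (2 / (1 + (m / Real.pi * (θ - θ₀)) ^ 2) + 2 / (1 + (m / Real.pi * (θ - θ₀)) ^ 2)) ^ 2 := by
        gcongr
    _ = _ := by rw [← add_div, div_pow]; norm_num

theorem integral_fejerPoly_sq_le {m : ℕ} (hm : 1 ≤ m) {θ₀ : ℝ} (h₀ : θ₀ ∈ Icc 0 Real.pi) :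
    ∫ x in (-1:ℝ)..1, (fejerPoly m θ₀).eval x ^ 2 ≤
      16 * Real.pi ^ 2 / m * (Real.sin θ₀ + Real.pi / m) := by
  have hm0 : (1:ℝ) ≤ m := by exact_mod_cast hm
  have hpi := Real.pi_pos
  have hs₀ := Real.sin_nonneg_of_mem_Icc h₀
  rw [← integral_comp_cos_mul_sin (f := fun x => (fejerPoly m θ₀).eval x ^ 2) (by fun_prop)]
  have hcont : Continuous fun θ : ℝ => (1 + (m / Real.pi * θ - m / Real.pi * θ₀) ^ 2)⁻¹ :=
    Continuous.inv₀ (by fun_prop) fun θ => by positivity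
  calc _ ≤ ∫ θ in (0:ℝ)..Real.pi, 16 * (Real.sin θ₀ + Real.pi / m) *
        (1 + (m / Real.pi * θ - m / Real.pi * θ₀) ^ 2)⁻¹ := by
        refine intervalIntegral.integral_mono_on hpi.le
          (Continuous.intervalIntegrable (by fun_prop) _ _)
          (Continuous.intervalIntegrable (by fun_prop) _ _) fun θ hθ => ?_
        have hq := eval_fejerPoly_sq_le hm hθ h₀
        rw [← mul_sub]
        set w := m / Real.pi * (θ - θ₀) with hw
        have hsin : Real.sin θ ≤ Real.sin θ₀ + Real.pi / m * |w| := by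
          have e : Real.pi / m * |w| = |θ - θ₀| := by
            rw [hw, abs_mul, abs_of_nonneg (a := (m:ℝ) / Real.pi) (by positivity)]; field_simp
          rw [e]
          have := (abs_le.mp (Real.abs_sin_sub_sin_le θ θ₀)).2
          linarith
        have hw2 : |w| ≤ 1 + w ^ 2 := by
          rw [← sq_abs w]; nlinarith [abs_nonneg w]
        have hs := Real.sin_nonneg_of_mem_Icc hθ
        have hb : Real.sin θ ≤ (Real.sin θ₀ + Real.pi / m) * (1 + w ^ 2) := by
          have : 0 ≤ Real.pi / m := by positivity
          nlinarith [sq_nonneg w, mul_nonneg hs₀ (sq_nonneg w)]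
        calc _ ≤ 16 / (1 + w ^ 2) ^ 2 * ((Real.sin θ₀ + Real.pi / m) * (1 + w ^ 2)) := by gcongr
          _ = _ := by field_simp
    _ = 16 * (Real.sin θ₀ + Real.pi / m) * ((m / Real.pi)⁻¹ *
        (Real.arctan (m / Real.pi * Real.pi - m / Real.pi * θ₀) -
          Real.arctan (m / Real.pi * 0 - m / Real.pi * θ₀))) := by
        rw [intervalIntegral.integral_const_mul, intervalIntegral.integral_comp_mul_sub
          (fun x => (1 + x ^ 2)⁻¹) (by positivity), integral_inv_one_add_sq, smul_eq_mul]
    _ ≤ 16 * (Real.sin θ₀ + Real.pi / m) * ((m / Real.pi)⁻¹ * Real.pi) := by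
        gcongr
        linarith [Real.arctan_lt_pi_div_two (m / Real.pi * Real.pi - m / Real.pi * θ₀),
          Real.neg_pi_div_two_lt_arctan (m / Real.pi * 0 - m / Real.pi * θ₀)]
    _ = _ := by field_simp

/-- Upper bound for the Christoffel function of `[0, 1]`. -/
theorem exists_polynomial_integral_sq_le (n : ℕ) (hn : 1 ≤ n) {y : ℝ} (hy : y ∈ Icc (0:ℝ) 1) :
    ∃ q : Polynomial ℝ, q.natDegree ≤ n / 2 ∧ q.eval y = 1 ∧
      ∫ t in (0:ℝ)..1, q.eval t ^ 2 ≤ 3000 / n * √(y + 1 / n ^ 2) := by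
  have hn0 : (1:ℝ) ≤ n := by exact_mod_cast hn
  obtain ⟨hy0, hy1⟩ := hy
  set m := n / 2 + 1 with hmdef
  have hm : 1 ≤ m := by omega
  have hmn : (n:ℝ) ≤ 2 * m := by exact_mod_cast (by omega : n ≤ 2 * m)
  have hm0 : (1:ℝ) ≤ m := by exact_mod_cast hm
  have hcos : Real.cos (Real.arccos (1 - 2 * y)) = 1 - 2 * y :=
    Real.cos_arccos (by linarith) (by linarith)
  have h₀ : Real.arccos (1 - 2 * y) ∈ Icc 0 Real.pi :=
    ⟨Real.arccos_nonneg _, Real.arccos_le_pi _⟩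
  have hsin : Real.sin (Real.arccos (1 - 2 * y)) ≤ 2 * √y := by
    rw [Real.sin_arccos, show 1 - (1 - 2 * y) ^ 2 = 2 ^ 2 * (y * (1 - y)) by ring,
      Real.sqrt_mul (by positivity), Real.sqrt_sq (by norm_num)]
    refine mul_le_mul_of_nonneg_left (Real.sqrt_le_sqrt ?_) (by norm_num)
    nlinarith
  have h1 := one_le_eval_fejerPoly hm (Real.arccos (1 - 2 * y))
  have hI := integral_fejerPoly_sq_le hm h₀
  have hd := natDegree_fejerPoly_le m (Real.arccos (1 - 2 * y))
  rw [hcos] at h1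
  set G := fejerPoly m (Real.arccos (1 - 2 * y))
  set s := Real.sin (Real.arccos (1 - 2 * y))
  set A := G.eval (1 - 2 * y)
  set Q := G.comp (Polynomial.C 1 - Polynomial.C 2 * Polynomial.X) with hQdef
  have hev : ∀ x, Q.eval x = G.eval (1 - 2 * x) := by
    intro x; rw [hQdef, Polynomial.eval_comp]; congr 1; simp
  refine ⟨Polynomial.C A⁻¹ * Q, ?_, ?_, ?_⟩
  · refine (Polynomial.natDegree_C_mul_le _ _).trans (Polynomial.natDegree_comp_le.trans ?_)
    refine (Nat.mul_le_mul hd (?_ : _ ≤ 1)).trans (by omega)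
    compute_degree
  · rw [Polynomial.eval_mul, Polynomial.eval_C, hev]
    exact inv_mul_cancel₀ (by positivity)
  · have h_int : ∫ t in (0:ℝ)..1, G.eval (1 - 2 * t) ^ 2 =
        1 / 2 * ∫ x in (-1:ℝ)..1, G.eval x ^ 2 := by
      have := intervalIntegral.integral_comp_sub_mul (a := 0) (b := 1)
        (fun t => G.eval t ^ 2) (c := 2) (by norm_num) 1
      rw [this]; norm_num
    have hA : (A⁻¹) ^ 2 ≤ 1 := pow_le_one₀ (by positivity) (inv_le_one_of_one_le₀ h1)
    have hpi := Real.pi_pos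
    have hpi2 := Real.pi_lt_d2
    have hI0 : 0 ≤ ∫ x in (-1:ℝ)..1, G.eval x ^ 2 :=
      intervalIntegral.integral_nonneg (by norm_num) fun _ _ => sq_nonneg _
    simp_rw [Polynomial.eval_mul, Polynomial.eval_C, hev, mul_pow]
    rw [intervalIntegral.integral_const_mul, h_int]
    have hm' : (m:ℝ)⁻¹ ≤ 2 / n := by
      rw [inv_le_comm₀ (by positivity) (by positivity), inv_div]; linarith
    have hsq1 : √y ≤ √(y + 1 / n ^ 2) := Real.sqrt_le_sqrt (by simp)
    have hsq2 : 1 / n ≤ √(y + 1 / n ^ 2) := by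
      apply Real.le_sqrt_of_sq_le
      rw [div_pow, one_pow]; linarith
    set W := √(y + 1 / n ^ 2)
    have hs0 : 0 ≤ s := Real.sin_nonneg_of_mem_Icc h₀
    calc _ ≤ 1 * (1 / 2 * (16 * Real.pi ^ 2 / m * (s + Real.pi / m))) := by gcongr
      _ = 8 * Real.pi ^ 2 * (m:ℝ)⁻¹ * (s + Real.pi * (m:ℝ)⁻¹) := by field_simp; ring
      _ ≤ 8 * 3.15 ^ 2 * (2 / n) * (2 * W + 3.15 * (2 * W)) := by
        have : (m:ℝ)⁻¹ ≤ 2 * W := hm'.trans (by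
          rw [show (2:ℝ) / n = 2 * (1 / n) by ring]; gcongr)
        gcongr
        exact hsin.trans (by gcongr)
      _ ≤ _ := by
        rw [show 8 * (3.15:ℝ) ^ 2 * (2 / n) * (2 * W + 3.15 * (2 * W)) =
          (8 * 3.15 ^ 2 * 2 * (2 + 3.15 * 2)) * (W / n) by ring,
          show 3000 / n * W = 3000 * (W / n) by ring]
        gcongr; norm_num

/-- A planar convex body in normal position at the origin contains, near the origin, the region above
a parabola, and up to constants the aperture of the parabola is certified by a supporting line. -/
theorem exists_parabola_subset {K : Set (ℝ × ℝ)} (hc : Convex ℝ K) (hk : IsCompact K)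
    (h0 : ((0:ℝ), (0:ℝ)) ∈ K) (h1 : ((1:ℝ), (1:ℝ)) ∈ K) (h2 : ((-1:ℝ), (1:ℝ)) ∈ K)
    (h3 : ∀ t : ℝ, |t| ≤ 1 / 2 → (t, (5 / 4 : ℝ)) ∈ K) {δ : ℝ} (hδ : 0 < δ) :
    ∃ a : ℝ, 1 ≤ a ∧
      (∀ t y : ℝ, |t| ≤ 1 / 2 → δ + a * t ^ 2 / 4 ≤ y → y ≤ 5 / 4 → (t, y) ∈ K) ∧
      (a = 1 ∨ ∃ s h : ℝ, s ≠ 0 ∧ |s| ≤ 2 ∧ 0 ≤ h ∧ (∃ z ∈ K, s * z.1 - z.2 = h) ∧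
        (∀ z ∈ K, s * z.1 - z.2 ≤ h) ∧ a * (δ + h) ≤ 2 * s ^ 2) := by
  have hex : ∀ s : ℝ, ∃ z ∈ K, ∀ w ∈ K, s * w.1 - w.2 ≤ s * z.1 - z.2 := fun s =>
    hk.exists_isMaxOn (f := fun w => s * w.1 - w.2) ⟨_, h0⟩ (Continuous.continuousOn (by fun_prop))
  choose z hz hmax using hex
  let H : ℝ → ℝ := fun s => s * (z s).1 - (z s).2
  have hH0 : ∀ s, 0 ≤ H s := fun s => by
    have := hmax s _ h0
    simp only [mul_zero, sub_zero] at this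
    exact this
  let S : Set ℝ := (fun s => s ^ 2 / (δ + H s)) '' Icc (-2) 2
  have hS0 : (0:ℝ) ∈ S := ⟨0, by norm_num, by simp⟩
  have hSb : BddAbove S := by
    refine ⟨4 / δ, ?_⟩
    rintro _ ⟨s, hs, rfl⟩
    have h4 : s ^ 2 ≤ 4 := by nlinarith [hs.1, hs.2]
    have := hH0 s
    show s ^ 2 / (δ + H s) ≤ 4 / δ
    gcongr
    linarith
  refine ⟨max 1 (sSup S), le_max_left _ _, ?_, ?_⟩
  · intro t y ht hy hy'
    set a := max 1 (sSup S) with ha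
    have ha1 : 1 ≤ a := le_max_left _ _
    by_contra hn
    obtain ⟨f, u, hf, hu⟩ := geometric_hahn_banach_closed_point hc hk.isClosed hn
    have hfe : ∀ p q : ℝ, f (p, q) = f (1, 0) * p + f (0, 1) * q := by
      intro p q
      have : ((p, q) : ℝ × ℝ) = p • (1, 0) + q • (0, 1) := by simp
      rw [this, map_add, map_smul, map_smul]
      simp [mul_comm]
    set A := f (1, 0)
    set B := f (0, 1)
    have key : ∀ w ∈ K, A * w.1 + B * w.2 < A * t + B * y := by
      intro w hw
      rw [← hfe, ← hfe]
      exact (hf w hw).trans hu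
    have hB : B < 0 := by
      by_contra hB
      have := key _ (h3 t ht)
      simp only at this
      nlinarith
    set s := A / (-B) with hs
    have hsA : A = s * (-B) := by rw [hs, div_mul_cancel₀ _ (neg_ne_zero.mpr hB.ne)]
    have key2 : ∀ w ∈ K, s * w.1 - w.2 < s * t - y := by
      intro w hw
      have := key w hw
      rw [hsA] at this
      have h' : 0 < (-B) * ((s * t - y) - (s * w.1 - w.2)) := by linarith
      have := (mul_pos_iff_of_pos_left (by linarith : 0 < -B)).mp h'
      linarith
    have hy0 : 0 ≤ y := by
      have : 0 ≤ a * t ^ 2 := by positivity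
      linarith
    have hst : s * t ≤ |s| * (1 / 2) := by
      calc _ ≤ |s * t| := le_abs_self _
        _ = |s| * |t| := abs_mul _ _
        _ ≤ _ := by gcongr
    have hs2 : |s| ≤ 2 := by
      have k1 := key2 _ h1
      have k2 := key2 _ h2
      simp only at k1 k2
      rcases abs_cases s with ⟨e, _⟩ | ⟨e, _⟩ <;> rw [e] at hst ⊢ <;> linarith
    have hmem : s ^ 2 / (δ + H s) ∈ S := ⟨s, abs_le.mp hs2, rfl⟩
    have hle : s ^ 2 / (δ + H s) ≤ a := (le_csSup hSb hmem).trans (le_max_right _ _)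
    have hpos : 0 < δ + H s := by linarith [hH0 s]
    rw [div_le_iff₀ hpos] at hle
    have hk3 : H s < s * t - y := key2 _ (hz s)
    nlinarith [sq_nonneg (s - a * t / 2), mul_lt_mul_of_pos_left hk3 (by linarith : 0 < a)]
  · rcases le_or_gt (sSup S) 1 with h | h
    · exact Or.inl (max_eq_left h)
    · right
      rw [max_eq_right h.le]
      obtain ⟨_, ⟨s, hs, rfl⟩, hlt⟩ := exists_lt_of_lt_csSup ⟨_, hS0⟩
        (by linarith : sSup S / 2 < sSup S)
      have hpos : 0 < δ + H s := by linarith [hH0 s]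
      simp only at hlt
      have hlt' := (lt_div_iff₀ hpos).mp hlt
      refine ⟨s, H s, ?_, abs_le.mpr hs, hH0 s, ⟨z s, hz s, rfl⟩, hmax s, by linarith⟩
      rintro rfl
      nlinarith

theorem intervalIntegral_intervalIntegral_le_setIntegral {K : Set (ℝ × ℝ)} (hk : IsCompact K)
    {G : ℝ × ℝ → ℝ} (hG : Continuous G) (hG0 : ∀ z, 0 ≤ G z) {φ : ℝ → ℝ} (hφ : Continuous φ)
    {τ κ : ℝ} (hτ : 0 ≤ τ) (hκ : 0 ≤ κ)
    (hK : ∀ t y, |t| ≤ τ → φ t ≤ y → y ≤ φ t + κ → (t, y) ∈ K) :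
    ∫ t in (-τ)..τ, ∫ y in (φ t)..(φ t + κ), G (t, y) ≤ ∫ z in K, G z := by
  let P : Set (ℝ × ℝ) := {z | z.1 ∈ Icc (-τ) τ ∧ φ z.1 ≤ z.2 ∧ z.2 ≤ φ z.1 + κ}
  have hPK : P ⊆ K := fun z hz => hK z.1 z.2 (abs_le.mpr hz.1) hz.2.1 hz.2.2
  have hPc : IsClosed P :=
    (isClosed_Icc.preimage continuous_fst).inter ((isClosed_le (hφ.comp continuous_fst) continuous_snd).inter
      (isClosed_le continuous_snd ((hφ.comp continuous_fst).add continuous_const)))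
  have h_int : Integrable (P.indicator G) (volume.prod volume) := by
    rw [integrable_indicator_iff hPc.measurableSet]
    exact (hG.continuousOn.integrableOn_compact (hk.of_isClosed_subset hPc hPK))
  calc ∫ t in (-τ)..τ, ∫ y in (φ t)..(φ t + κ), G (t, y)
      = ∫ t, ∫ y, P.indicator G (t, y) := by
        rw [intervalIntegral.integral_of_le (by linarith), ← integral_Icc_eq_integral_Ioc,
          ← integral_indicator measurableSet_Icc]
        congr 1
        ext t
        by_cases ht : t ∈ Icc (-τ) τ
        · rw [indicator_of_mem ht, intervalIntegral.integral_of_le (by linarith),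
            ← integral_Icc_eq_integral_Ioc, ← integral_indicator measurableSet_Icc]
          congr 1
          ext y
          by_cases hy : y ∈ Icc (φ t) (φ t + κ)
          · rw [indicator_of_mem hy, indicator_of_mem (show (t, y) ∈ P from ⟨ht, hy⟩)]
          · rw [indicator_of_notMem hy, indicator_of_notMem (fun h : (t, y) ∈ P => hy h.2)]
        · rw [indicator_of_notMem ht]
          symm
          have : ∀ y, P.indicator G (t, y) = 0 := fun y =>
            indicator_of_notMem (fun h : (t, y) ∈ P => ht h.1) _
          simp [this]
    _ = ∫ z in P, G z := by
        rw [← integral_prod _ h_int, ← Measure.volume_eq_prod, integral_indicator hPc.measurableSet]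
    _ ≤ ∫ z in K, G z :=
        setIntegral_mono_set (hG.continuousOn.integrableOn_compact hk)
          (Filter.Eventually.of_forall hG0) hPK.eventuallyLE

theorem eval_aeval_polynomial (p : MvPolynomial (Fin 2) ℝ) (f g : Polynomial ℝ) (s : ℝ) :
    (MvPolynomial.aeval ![f, g] p).eval s = MvPolynomial.eval ![f.eval s, g.eval s] p := by
  have := MvPolynomial.map_aeval ![f, g] (Polynomial.evalRingHom s) p
  rw [Polynomial.coe_evalRingHom] at this
  rw [this, MvPolynomial.eval]
  congr 2
  · ext; simp
  · ext i; fin_cases i <;> simp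

theorem continuous_eval_pair (p : MvPolynomial (Fin 2) ℝ) :
    Continuous fun z : ℝ × ℝ => MvPolynomial.eval ![z.1, z.2] p :=
  (MvPolynomial.continuous_eval p).comp
    (continuous_pi (Fin.forall_fin_two.mpr ⟨continuous_fst, continuous_snd⟩))

theorem sq_eval_mul_sqrt_le_of_parabola_subset {K : Set (ℝ × ℝ)} (hk : IsCompact K) {n : ℕ}
    (hn : 1 ≤ n) (p : MvPolynomial (Fin 2) ℝ) (hp : p.totalDegree ≤ 2 * n) {y₀ a : ℝ}
    (hy : y₀ ∈ Icc (0:ℝ) 1) (ha : 1 ≤ a)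
    (hK : ∀ t y : ℝ, |t| ≤ 1 / 2 → (y₀ + 1 / n ^ 2) / 300 + a * t ^ 2 / 4 ≤ y → y ≤ 5 / 4 →
      (t, y) ∈ K) :
    MvPolynomial.eval ![0, y₀] p ^ 2 * (√(y₀ + 1 / n ^ 2) / √a) ≤
      3 * 10 ^ 9 * n ^ 2 * ∫ z in K, MvPolynomial.eval ![z.1, z.2] p ^ 2 := by
  have hn0 : (1:ℝ) ≤ n := by exact_mod_cast hn
  have hn2 : 0 < 1 / (n:ℝ) ^ 2 ∧ 1 / (n:ℝ) ^ 2 ≤ 1 :=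
    ⟨by positivity, by rw [div_le_one (by positivity)]; exact one_le_pow₀ hn0⟩
  have hsa : 1 ≤ √a := Real.one_le_sqrt.mpr ha
  have hsa2 : √a ^ 2 = a := Real.sq_sqrt (by linarith)
  set N := 1 / (n:ℝ) ^ 2 with hN
  set η := y₀ + N with hη
  set δ := η / 300 with hδ
  obtain ⟨hy0, hy1⟩ := hy
  let τ : ℝ := 1 / (2 * √a)
  have hτ : 0 < τ := by positivity
  have hτ2 : a * τ ^ 2 = 1 / 4 := by
    simp only [τ]; rw [div_pow, mul_pow, hsa2]; field_simp; norm_num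
  have hτ1 : τ ≤ 1 / 2 := by
    simp only [τ]; gcongr; linarith
  let φ : ℝ → ℝ := fun t => δ + a * t ^ 2 / 4
  have hφ : Continuous φ := by fun_prop
  let G : ℝ × ℝ → ℝ := fun z => MvPolynomial.eval ![z.1, z.2] p
  have hG : Continuous G := continuous_eval_pair p
  set I := ∫ z in K, G z ^ 2 with hI
  have hsub : ∫ t in (-τ)..τ, ∫ y in (φ t)..(φ t + 9 / 8), G (t, y) ^ 2 ≤ I := by
    refine intervalIntegral_intervalIntegral_le_setIntegral hk (G := fun z => G z ^ 2)
      (by fun_prop) (fun z => sq_nonneg _) hφ hτ.le (by norm_num) ?_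
    intro t y ht h1 h2
    refine hK t y (ht.trans hτ1) h1 (h2.trans ?_)
    have : a * t ^ 2 ≤ a * τ ^ 2 := by
      rw [← sq_abs t]; gcongr
    simp only [φ]
    linarith
  have hA : ∀ t, ∫ y in (φ t)..(φ t + 9 / 8), G (t, y) ^ 2 =
      9 / 8 * ∫ s in (0:ℝ)..1, G (t, 9 / 8 * s + φ t) ^ 2 := by
    intro t
    rw [intervalIntegral.integral_comp_mul_add (fun y => G (t, y) ^ 2) (by norm_num) (φ t),
      smul_eq_mul, ← mul_assoc]
    norm_num [add_comm]
  let d := y₀ - δ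
  have step1 : ∀ t, G (t, d + φ t) ^ 2 * (√η / 2) ≤
      20000 * n * ∫ s in (0:ℝ)..1, G (t, 9 / 8 * s + φ t) ^ 2 := by
    intro t
    let f : Polynomial ℝ := MvPolynomial.aeval
      ![Polynomial.C t, Polynomial.C (9 / 8) * Polynomial.X + Polynomial.C (φ t)] p
    have hf : f.natDegree ≤ 2 * n := by
      have := MvPolynomial.aeval_natDegree_le (n := 1) p hp
        ![Polynomial.C t, Polynomial.C (9 / 8) * Polynomial.X + Polynomial.C (φ t)]
        (Fin.forall_fin_two.mpr ⟨by simp, Polynomial.natDegree_linear_le⟩)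
      simpa using this
    have hfe : ∀ s, f.eval s = G (t, 9 / 8 * s + φ t) := by
      intro s
      simp only [f, G, eval_aeval_polynomial]
      simp
    have := sq_eval_mul_sqrt_le f (m := 2 * n) (by omega) hf (y := 8 / 9 * d) (w := η / 4)
      (by
        push_cast
        have : 1 / (64 * (2 * (n:ℝ)) ^ 2) = N / 256 := by rw [hN]; field_simp; norm_num
        rw [this]; simp only [d]; linarith)
      (by simp only [d]; linarith)
      (by
        push_cast
        have : 2 / (2 * (n:ℝ)) ^ 2 = N / 2 := by rw [hN]; field_simp
        rw [this]; simp only [d]; linarith)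
    simp only [hfe] at this
    have e1 : √(η / 4) = √η / 2 := by
      rw [Real.sqrt_div' _ (by norm_num), show (4:ℝ) = 2 ^ 2 by norm_num,
        Real.sqrt_sq (by norm_num)]
    rw [e1, show 9 / 8 * (8 / 9 * d) + φ t = d + φ t by ring] at this
    push_cast at this
    linarith
  have step2 : G (0, y₀) ^ 2 * (7 / 10) ≤
      40000 * n * ∫ r in (0:ℝ)..1, G (2 * τ * r - τ, d + φ (2 * τ * r - τ)) ^ 2 := by
    let l : Polynomial ℝ := Polynomial.C (2 * τ) * Polynomial.X + Polynomial.C (-τ)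
    let l' : Polynomial ℝ := Polynomial.C (d + δ) + Polynomial.C (a / 4) * l ^ 2
    have hl : l.natDegree ≤ 1 := Polynomial.natDegree_linear_le
    have hl' : l'.natDegree ≤ 2 := by
      refine (Polynomial.natDegree_add_le _ _).trans (max_le (by simp) ?_)
      refine (Polynomial.natDegree_C_mul_le _ _).trans (Polynomial.natDegree_pow_le.trans ?_)
      omega
    let f : Polynomial ℝ := MvPolynomial.aeval ![l, l'] p
    have hf : f.natDegree ≤ 4 * n := by
      have := MvPolynomial.aeval_natDegree_le (n := 2) p hp ![l, l']
        (Fin.forall_fin_two.mpr ⟨hl.trans (by norm_num), hl'⟩)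
      refine this.trans (by omega)
    have hfe : ∀ r, f.eval r = G (2 * τ * r - τ, d + φ (2 * τ * r - τ)) := by
      intro r
      simp only [f, G, φ, eval_aeval_polynomial, l, l']
      simp only [Polynomial.eval_add, Polynomial.eval_mul, Polynomial.eval_C, Polynomial.eval_X,
        Polynomial.eval_pow]
      congr 2
      ext i
      fin_cases i <;> simp <;> ring
    have := sq_eval_mul_sqrt_le f (m := 4 * n) (by omega) hf (y := 1 / 2) (w := 1 / 2)
      (by
        have : 0 ≤ 1 / (64 * ((4 * n : ℕ) : ℝ) ^ 2) := by positivity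
        linarith) (by norm_num)
      (by
        have : 0 ≤ 2 / ((4 * n : ℕ) : ℝ) ^ 2 := by positivity
        linarith)
    simp only [hfe] at this
    have e : G (2 * τ * (1 / 2) - τ, d + φ (2 * τ * (1 / 2) - τ)) = G (0, y₀) := by
      congr 2
      · ring
      · simp only [φ, d]; ring
    have e2 : 7 / 10 ≤ √(1 / 2 : ℝ) := Real.le_sqrt_of_sq_le (by norm_num)
    rw [e] at this
    push_cast at this
    have := mul_le_mul_of_nonneg_left e2 (sq_nonneg (G (0, y₀)))
    linarith
  set Q := ∫ r in (0:ℝ)..1, G (2 * τ * r - τ, d + φ (2 * τ * r - τ)) ^ 2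
  have hQ : ∫ t in (-τ)..τ, G (t, d + φ t) ^ 2 = 2 * τ * Q := by
    simp only [Q]
    rw [intervalIntegral.integral_comp_mul_sub (fun t => G (t, d + φ t) ^ 2) (by positivity) τ,
      smul_eq_mul, ← mul_assoc, mul_inv_cancel₀ (by positivity), one_mul]
    congr 1 <;> ring
  have step3 : √η / 2 * (2 * τ * Q) ≤ 20000 * n * (8 / 9 * I) := by
    rw [← hQ, ← intervalIntegral.integral_const_mul]
    calc _ ≤ ∫ t in (-τ)..τ, 20000 * n * ∫ s in (0:ℝ)..1, G (t, 9 / 8 * s + φ t) ^ 2 := by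
          refine intervalIntegral.integral_mono_on (by linarith)
            (Continuous.intervalIntegrable (by fun_prop) _ _)
            (Continuous.intervalIntegrable ?_ _ _) (fun t _ => ?_)
          · refine continuous_const.mul
              (intervalIntegral.continuous_parametric_intervalIntegral_of_continuous' ?_ _ _)
            simp only [Function.uncurry_def]
            fun_prop
          · rw [mul_comm]; exact step1 t
      _ = 20000 * n * (8 / 9 * ∫ t in (-τ)..τ, ∫ y in (φ t)..(φ t + 9 / 8), G (t, y) ^ 2) := by
          simp only [hA]
          rw [intervalIntegral.integral_const_mul, intervalIntegral.integral_const_mul]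
          ring
      _ ≤ _ := by gcongr
  have hτe : √η / √a = √η / 2 * (2 * τ) * 2 := by simp only [τ]; field_simp
  have hnn : 0 ≤ √η / √a := by positivity
  have hI0 : 0 ≤ I := integral_nonneg fun _ => sq_nonneg _
  have h5 : √η / √a * Q ≤ 2 * (20000 * n * (8 / 9 * I)) := by rw [hτe]; linarith
  have h6 := mul_le_mul_of_nonneg_right step2 hnn
  have h7 : 40000 * (n:ℝ) * (√η / √a * Q) ≤ 40000 * n * (2 * (20000 * n * (8 / 9 * I))) := by
    gcongr
  have h8 : 0 ≤ (n:ℝ) ^ 2 * I := by positivity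
  show G (0, y₀) ^ 2 * (√η / √a) ≤ _
  nlinarith

theorem setIntegral_sq_mul_le {K : Set (ℝ × ℝ)} {β σ γ : ℝ} (hσ : σ ≠ 0)
    (hK : ∀ z ∈ K, z.2 ∈ Icc (0:ℝ) 3 ∧ σ * z.1 + (β * z.2 + γ) ∈ Icc (0:ℝ) 1)
    (q₁ q₂ : Polynomial ℝ) :
    ∫ z in K, (q₁.eval (1 / 3 * z.2) * q₂.eval (σ * z.1 + (β * z.2 + γ))) ^ 2 ≤
      3 * (∫ t in (0:ℝ)..1, q₁.eval t ^ 2) * (|σ|⁻¹ * ∫ t in (0:ℝ)..1, q₂.eval t ^ 2) := by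
  let F : ℝ × ℝ → ℝ := fun z => (q₁.eval (1 / 3 * z.2) * q₂.eval (σ * z.1 + (β * z.2 + γ))) ^ 2
  have hF : Continuous F := by fun_prop
  let P : Set (ℝ × ℝ) := {z | z.2 ∈ Icc (0:ℝ) 3 ∧ σ * z.1 + (β * z.2 + γ) ∈ Icc (0:ℝ) 1}
  have hPcl : IsClosed P :=
    (isClosed_Icc.preimage continuous_snd).inter
      (isClosed_Icc.preimage (f := fun z : ℝ × ℝ => σ * z.1 + (β * z.2 + γ)) (by fun_prop))
  have hPc : IsCompact P := by
    have hc : IsCompact ((fun w : ℝ × ℝ => ((w.1 - (β * w.2 + γ)) / σ, w.2)) ''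
        (Icc (0:ℝ) 1 ×ˢ Icc (0:ℝ) 3)) :=
      (isCompact_Icc.prod isCompact_Icc).image (by fun_prop)
    refine hc.of_isClosed_subset hPcl fun z hz => ⟨(σ * z.1 + (β * z.2 + γ), z.2), ⟨hz.2, hz.1⟩, ?_⟩
    ext
    · simp only [add_sub_cancel_right]; field_simp
    · rfl
  have hFi : IntegrableOn F P := hF.continuousOn.integrableOn_compact hPc
  have h_int : Integrable (P.indicator F) (volume.prod volume) := by
    rw [integrable_indicator_iff hPcl.measurableSet]
    exact hFi
  let I₁ : ℝ → ℝ := (Icc (0:ℝ) 3).indicator fun y => q₁.eval (1 / 3 * y) ^ 2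
  let I₂ : ℝ → ℝ := (Icc (0:ℝ) 1).indicator fun y => q₂.eval y ^ 2
  have hprod : ∀ x y, P.indicator F (x, y) = I₁ y * I₂ (σ * x + (β * y + γ)) := by
    intro x y
    simp only [I₁, I₂]
    by_cases h1 : y ∈ Icc (0:ℝ) 3
    · by_cases h2 : σ * x + (β * y + γ) ∈ Icc (0:ℝ) 1
      · rw [indicator_of_mem h1, indicator_of_mem h2, indicator_of_mem (show (x, y) ∈ P from ⟨h1, h2⟩)]
        exact mul_pow _ _ _
      · rw [indicator_of_notMem h2, indicator_of_notMem (fun h : (x, y) ∈ P => h2 h.2), mul_zero]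
    · rw [indicator_of_notMem h1, indicator_of_notMem (fun h : (x, y) ∈ P => h1 h.1), zero_mul]
  have hI1 : ∫ y, I₁ y = 3 * ∫ t in (0:ℝ)..1, q₁.eval t ^ 2 := by
    simp only [I₁]
    rw [integral_indicator measurableSet_Icc, integral_Icc_eq_integral_Ioc,
      ← intervalIntegral.integral_of_le (by norm_num),
      intervalIntegral.integral_comp_mul_left (fun t => q₁.eval t ^ 2) (by norm_num)]
    norm_num
  have hI2 : ∫ y, I₂ y = ∫ t in (0:ℝ)..1, q₂.eval t ^ 2 := by
    simp only [I₂]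
    rw [integral_indicator measurableSet_Icc, integral_Icc_eq_integral_Ioc,
      ← intervalIntegral.integral_of_le (by norm_num)]
  have hinner : ∀ c, ∫ x, I₂ (σ * x + c) = |σ|⁻¹ * ∫ y, I₂ y := by
    intro c
    rw [Measure.integral_comp_mul_left (fun r => I₂ (r + c)) σ, integral_add_right_eq_self I₂ c,
      abs_inv, smul_eq_mul]
  calc ∫ z in K, F z ≤ ∫ z in P, F z :=
        setIntegral_mono_set hFi (Filter.Eventually.of_forall fun z => sq_nonneg _)
          (LE.le.eventuallyLE hK)
    _ = ∫ y, ∫ x, P.indicator F (x, y) := by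
        rw [← integral_prod_symm _ h_int, ← Measure.volume_eq_prod,
          integral_indicator hPcl.measurableSet]
    _ = 3 * (∫ t in (0:ℝ)..1, q₁.eval t ^ 2) * (|σ|⁻¹ * ∫ t in (0:ℝ)..1, q₂.eval t ^ 2) := by
        simp only [hprod]
        simp_rw [integral_const_mul, hinner]
        rw [integral_mul_const, hI1, hI2]

theorem eval_aeval_mvPolynomial {ι : Type*} (v : ι → ℝ) (l : MvPolynomial ι ℝ) (q : Polynomial ℝ) :
    MvPolynomial.eval v (Polynomial.aeval l q) = q.eval (MvPolynomial.eval v l) := by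
  rw [Polynomial.aeval_def, Polynomial.hom_eval₂,
    show (MvPolynomial.eval v).comp (algebraMap ℝ (MvPolynomial ι ℝ)) = RingHom.id ℝ by ext; simp,
    Polynomial.eval₂_id]

theorem totalDegree_polynomial_aeval_le {ι : Type*} {l : MvPolynomial ι ℝ} (hl : l.totalDegree ≤ 1)
    (q : Polynomial ℝ) : (Polynomial.aeval l q).totalDegree ≤ q.natDegree := by
  rw [Polynomial.aeval_eq_sum_range]
  refine (MvPolynomial.totalDegree_finsetSum _ _).trans (Finset.sup_le fun i hi => ?_)
  refine (MvPolynomial.totalDegree_smul_le _ _).trans ((MvPolynomial.totalDegree_pow _ _).trans ?_)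
  have := Finset.mem_range.mp hi
  nlinarith

theorem totalDegree_linear_le {ι : Type*} (a b c : ℝ) (i j : ι) :
    (MvPolynomial.C a * MvPolynomial.X i +
      (MvPolynomial.C b * MvPolynomial.X j + MvPolynomial.C c)).totalDegree ≤ 1 := by
  have h : ∀ (a : ℝ) (i : ι), (MvPolynomial.C a * MvPolynomial.X i).totalDegree ≤ 1 := fun a i =>
    (MvPolynomial.totalDegree_mul _ _).trans (by simp)
  exact (MvPolynomial.totalDegree_add _ _).trans (max_le (h a i)
    ((MvPolynomial.totalDegree_add _ _).trans (max_le (h b j) (by simp))))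

/-- Product test polynomial adapted to two linear forms. -/
theorem exists_mvPolynomial_setIntegral_le {K : Set (ℝ × ℝ)} {β σ γ : ℝ} (hσ : σ ≠ 0)
    (hK : ∀ z ∈ K, z.2 ∈ Icc (0:ℝ) 3 ∧ σ * z.1 + (β * z.2 + γ) ∈ Icc (0:ℝ) 1) {n : ℕ} (hn : 1 ≤ n)
    {y₀ : ℝ} (hy : (0, y₀) ∈ K) :
    ∃ q : MvPolynomial (Fin 2) ℝ, q.totalDegree ≤ n ∧ MvPolynomial.eval ![0, y₀] q = 1 ∧
      n ^ 2 * ∫ z in K, MvPolynomial.eval ![z.1, z.2] q ^ 2 ≤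
        27 * 10 ^ 6 * √(y₀ + 1 / n ^ 2) * (|σ|⁻¹ * √(β * y₀ + γ + 1 / n ^ 2)) := by
  obtain ⟨⟨hy0, hy3⟩, hm⟩ := hK _ hy
  simp only [mul_zero, zero_add] at hy0 hy3 hm
  obtain ⟨q₁, d₁, e₁, i₁⟩ := exists_polynomial_integral_sq_le n hn (y := 1 / 3 * y₀)
    ⟨by linarith, by linarith⟩
  obtain ⟨q₂, d₂, e₂, i₂⟩ := exists_polynomial_integral_sq_le n hn hm
  let l₁ : MvPolynomial (Fin 2) ℝ := MvPolynomial.C 0 * MvPolynomial.X 0 +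
    (MvPolynomial.C (1 / 3) * MvPolynomial.X 1 + MvPolynomial.C 0)
  let l₂ : MvPolynomial (Fin 2) ℝ := MvPolynomial.C σ * MvPolynomial.X 0 +
    (MvPolynomial.C β * MvPolynomial.X 1 + MvPolynomial.C γ)
  let q := Polynomial.aeval l₁ q₁ * Polynomial.aeval l₂ q₂
  have hq : ∀ t y : ℝ, MvPolynomial.eval ![t, y] q =
      q₁.eval (1 / 3 * y) * q₂.eval (σ * t + (β * y + γ)) := by
    intro t y
    simp only [q, map_mul, eval_aeval_mvPolynomial, l₁, l₂]
    simp
  refine ⟨q, ?_, ?_, ?_⟩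
  · refine (MvPolynomial.totalDegree_mul _ _).trans ?_
    have h1 := totalDegree_polynomial_aeval_le (totalDegree_linear_le 0 (1 / 3) 0 (0 : Fin 2) 1) q₁
    have h2 := totalDegree_polynomial_aeval_le (totalDegree_linear_le σ β γ (0 : Fin 2) 1) q₂
    simp only [l₁, l₂]
    omega
  · rw [hq, mul_zero, zero_add, e₁, e₂, one_mul]
  · simp only [hq]
    have hn0 : (0:ℝ) < n := by exact_mod_cast hn
    calc _ ≤ (n:ℝ) ^ 2 * (3 * (3000 / n * √(y₀ + 1 / n ^ 2)) *
          (|σ|⁻¹ * (3000 / n * √(β * y₀ + γ + 1 / n ^ 2)))) := by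
          gcongr
          refine (setIntegral_sq_mul_le hσ hK q₁ q₂).trans ?_
          have i₁' : ∫ t in (0:ℝ)..1, q₁.eval t ^ 2 ≤ 3000 / n * √(y₀ + 1 / n ^ 2) :=
            i₁.trans (by gcongr; linarith)
          have h0 : 0 ≤ ∫ t in (0:ℝ)..1, q₂.eval t ^ 2 :=
            intervalIntegral.integral_nonneg zero_le_one fun _ _ => sq_nonneg _
          gcongr
      _ = _ := by field_simp; ring

/-- Comparison of Christoffel functions for a planar convex body in normal position. -/
theorem exists_mvPolynomial_mul_setIntegral_le {K : Set (ℝ × ℝ)} (hc : Convex ℝ K)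
    (hk : IsCompact K) (hb : ∀ z ∈ K, z.2 ∈ Icc (0:ℝ) 3 ∧ |z.1| ≤ 12)
    (h0 : ((0:ℝ), (0:ℝ)) ∈ K) (h1 : ((1:ℝ), (1:ℝ)) ∈ K) (h2 : ((-1:ℝ), (1:ℝ)) ∈ K)
    (h3 : ∀ t : ℝ, |t| ≤ 1 / 2 → (t, (5 / 4 : ℝ)) ∈ K) {n : ℕ} (hn : 1 ≤ n)
    {y₀ : ℝ} (hy1 : y₀ ≤ 1) (hy : (0, y₀) ∈ K) (p : MvPolynomial (Fin 2) ℝ)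
    (hp : p.totalDegree ≤ 2 * n) :
    ∃ q : MvPolynomial (Fin 2) ℝ, q.totalDegree ≤ n ∧ MvPolynomial.eval ![0, y₀] q = 1 ∧
      MvPolynomial.eval ![0, y₀] p ^ 2 * ∫ z in K, MvPolynomial.eval ![z.1, z.2] q ^ 2 ≤
        10 ^ 21 * ∫ z in K, MvPolynomial.eval ![z.1, z.2] p ^ 2 := by
  have hn0 : (1:ℝ) ≤ n := by exact_mod_cast hn
  have hn2 : 0 < 1 / (n:ℝ) ^ 2 ∧ 1 / (n:ℝ) ^ 2 ≤ 1 :=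
    ⟨by positivity, by rw [div_le_one (by positivity)]; exact one_le_pow₀ hn0⟩
  have hy0 : 0 ≤ y₀ := (hb _ hy).1.1
  set η := y₀ + 1 / (n:ℝ) ^ 2 with hη
  have hη0 : 0 < η := by linarith
  obtain ⟨a, ha, hpar, hcase⟩ := exists_parabola_subset hc hk h0 h1 h2 h3
    (by positivity : 0 < η / 300)
  have low := sq_eval_mul_sqrt_le_of_parabola_subset hk hn p hp ⟨hy0, hy1⟩ ha hpar
  rw [← hη] at low
  have hsa : 0 < √a := Real.sqrt_pos.mpr (by linarith)
  have key : ∃ q : MvPolynomial (Fin 2) ℝ, q.totalDegree ≤ n ∧ MvPolynomial.eval ![0, y₀] q = 1 ∧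
      n ^ 2 * ∫ z in K, MvPolynomial.eval ![z.1, z.2] q ^ 2 ≤
        27 * 10 ^ 6 * √η * (51 * (25 / √a)) := by
    rcases hcase with rfl | ⟨s, h, hs, hs2, hh, ⟨z, hz, hzh⟩, hmax, hle⟩
    · obtain ⟨q, d, e, i⟩ := exists_mvPolynomial_setIntegral_le (K := K) (β := 0) (σ := 1 / 24)
        (γ := 1 / 2) (by norm_num) (fun z hz => by
          obtain ⟨h1, h2⟩ := hb z hz
          rw [abs_le] at h2
          exact ⟨h1, by constructor <;> linarith⟩) hn hy
      refine ⟨q, d, e, i.trans ?_⟩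
      rw [← hη, Real.sqrt_one]
      have : √(0 * y₀ + 1 / 2 + 1 / (n:ℝ) ^ 2) ≤ 2 := Real.sqrt_le_iff.mpr ⟨by norm_num, by linarith⟩
      have e : |(1 / 24 : ℝ)|⁻¹ = 24 := by norm_num
      rw [e, div_one]
      refine mul_le_mul_of_nonneg_left ?_ (by positivity)
      linarith
    · have hst : ∀ z ∈ K, |s * z.1| ≤ 24 := fun z hz => by
        rw [abs_mul]
        have := (hb z hz).2
        nlinarith [abs_nonneg s, abs_nonneg z.1]
      have hh24 : h ≤ 24 := by
        have := (abs_le.mp (hst z hz)).2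
        have := (hb z hz).1.1
        linarith
      obtain ⟨q, d, e, i⟩ := exists_mvPolynomial_setIntegral_le (K := K) (β := 1 / 51)
        (σ := -s / 51) (γ := h / 51) (by simp [hs]) (fun w hw => by
          obtain ⟨h1, -⟩ := hb w hw
          have h2 := abs_le.mp (hst w hw)
          have h3 := hmax w hw
          refine ⟨h1, ?_, ?_⟩ <;> linarith [h1.1, h1.2]) hn hy
      refine ⟨q, d, e, i.trans ?_⟩
      rw [← hη]
      have hs0 : 0 < |s| := abs_pos.mpr hs
      have e1 : |-s / 51|⁻¹ = 51 / |s| := by rw [abs_div, abs_neg, inv_div]; norm_num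
      have e2 : √(1 / 51 * y₀ + h / 51 + 1 / (n:ℝ) ^ 2) ≤ √(η + h) :=
        Real.sqrt_le_sqrt (by linarith)
      have e3 : √a * √(η + h) ≤ 25 * |s| := by
        rw [← Real.sqrt_mul (by linarith)]
        refine Real.sqrt_le_iff.mpr ⟨by positivity, ?_⟩
        rw [mul_pow, sq_abs]
        nlinarith [sq_nonneg s, mul_nonneg (by linarith : 0 ≤ a) hh]
      have e4 : √(η + h) / |s| ≤ 25 / √a := by
        rw [div_le_div_iff₀ hs0 hsa]; linarith
      rw [e1]
      refine mul_le_mul_of_nonneg_left ?_ (by positivity)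
      calc _ ≤ 51 / |s| * √(η + h) := by gcongr
        _ = 51 * (√(η + h) / |s|) := by ring
        _ ≤ _ := by gcongr
  obtain ⟨q, d, e, i⟩ := key
  refine ⟨q, d, e, ?_⟩
  set P := MvPolynomial.eval ![0, y₀] p ^ 2
  set I := ∫ z in K, MvPolynomial.eval ![z.1, z.2] p ^ 2
  set J := ∫ z in K, MvPolynomial.eval ![z.1, z.2] q ^ 2
  have hP : 0 ≤ P := sq_nonneg _
  have hI : 0 ≤ I := integral_nonneg fun _ => sq_nonneg _
  have hnn : (0:ℝ) < n ^ 2 := by positivity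
  refine le_of_mul_le_mul_left ?_ hnn
  calc (n:ℝ) ^ 2 * (P * J) = P * (n ^ 2 * J) := by ring
    _ ≤ P * (27 * 10 ^ 6 * √η * (51 * (25 / √a))) := mul_le_mul_of_nonneg_left i hP
    _ = 27 * 10 ^ 6 * 51 * 25 * (P * (√η / √a)) := by ring
    _ ≤ 27 * 10 ^ 6 * 51 * 25 * (3 * 10 ^ 9 * n ^ 2 * I) :=
      mul_le_mul_of_nonneg_left low (by norm_num)
    _ ≤ n ^ 2 * (10 ^ 21 * I) := by nlinarith [mul_nonneg hnn.le hI]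

/-- Every planar compact convex set has a point about which it is symmetric up to a factor `2`. -/
theorem exists_forall_three_halves_sub_mem {D : Set E2} (hc : Convex ℝ D) (hk : IsCompact D) :
    ∃ o : E2, ∀ y ∈ D, (3 / 2 : ℝ) • o - (1 / 2 : ℝ) • y ∈ D := by
  classical
  let F : D → Set E2 := fun y => {o | (3 / 2 : ℝ) • o - (1 / 2 : ℝ) • (y : E2) ∈ D}
  suffices h : (⋂ y, F y).Nonempty by
    obtain ⟨o, ho⟩ := h
    exact ⟨o, fun y hy => mem_iInter.mp ho ⟨y, hy⟩⟩
  have hF : ∀ y, F y = (fun d : E2 => (2 / 3 : ℝ) • d + (1 / 3 : ℝ) • (y : E2)) '' D := by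
    intro y
    ext o
    constructor
    · intro ho
      exact ⟨_, ho, by module⟩
    · rintro ⟨d, hd, rfl⟩
      show _ ∈ D
      convert hd using 1
      module
  refine Convex.helly_theorem_compact' (𝕜 := ℝ) (fun y => ?_) (fun y => ?_) (fun I hI => ?_)
  · intro a ha b hb s t hs ht hst
    show _ ∈ D
    convert hc ha hb hs ht hst using 1
    obtain rfl : t = 1 - s := by linarith
    module
  · rw [hF]
    exact hk.image (by fun_prop)
  · rcases I.eq_empty_or_nonempty with rfl | hne
    · simp
    · have hcard : 0 < I.card := hne.card_pos
      have hcard0 : (0:ℝ) < I.card := by exact_mod_cast hcard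
      have hcard3 : (I.card : ℝ) ≤ 3 := by
        have : I.card ≤ 3 := by simpa using hI
        exact_mod_cast this
      refine ⟨∑ i ∈ I, (1 / (I.card : ℝ)) • (i : E2), mem_iInter₂.mpr fun j hj => ?_⟩
      show _ ∈ D
      have h1 : 1 ≤ 3 / (I.card : ℝ) := by rw [le_div_iff₀ hcard0]; linarith
      have hm := hc.sum_mem (t := I)
        (w := fun i => 3 / 2 * (1 / (I.card : ℝ)) - if i = j then 1 / 2 else 0)
        (z := fun i => (i : E2)) (fun i _ => by
          have : (3 / 2 : ℝ) * (1 / I.card) = 1 / 2 * (3 / I.card) := by ring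
          rw [this]
          split_ifs <;> linarith)
        (by
          rw [Finset.sum_sub_distrib, Finset.sum_const, Finset.sum_ite_eq' I j, if_pos hj,
            nsmul_eq_mul]
          field_simp
          norm_num)
        (fun i _ => i.2)
      convert hm using 1
      simp only [sub_smul, mul_smul, ite_smul, zero_smul, Finset.sum_sub_distrib]
      rw [Finset.sum_ite_eq' I j, if_pos hj, Finset.smul_sum]

theorem exists_last_mem_ray {D : Set E2} (hk : IsCompact D) {o v : E2} (ho : o ∈ D) (hv : v ≠ 0) :
    ∃ s : ℝ, 0 ≤ s ∧ o + s • v ∈ D ∧ ∀ r : ℝ, o + r • v ∈ D → r ≤ s := by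
  have hemb := (Homeomorph.addLeft o).isClosedEmbedding.comp (isClosedEmbedding_smul_left (𝕜 := ℝ) hv)
  have hcomp := hemb.isCompact_preimage hk
  obtain ⟨s, hs, hmax⟩ := hcomp.exists_isMaxOn (f := id) ⟨0, by simpa using ho⟩ continuousOn_id
  exact ⟨s, hmax (show (0:ℝ) ∈ _ by simpa using ho), hs, fun r hr => hmax hr⟩

theorem exists_gt_mem_of_mem_interior {D : Set E2} {o v : E2} {s : ℝ}
    (h : o + s • v ∈ interior D) : ∃ r > s, o + r • v ∈ D := by
  have hcont : Continuous fun r : ℝ => o + r • v := by fun_prop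
  have hev : ∀ᶠ r in nhds s, o + r • v ∈ D :=
    hcont.continuousAt.preimage_mem_nhds (mem_interior_iff_mem_nhds.mp h)
  exact hev.exists_gt

/-- Normal position of a planar convex body with respect to a boundary point on the ray from an
interior point through a given point. -/
theorem exists_normal_position {D : Set E2} (hD : IsConvexBody D) {x : E2} (hx : x ∈ D) :
    ∃ (b : E2) (L : (ℝ × ℝ) ≃L[ℝ] E2) (y₀ : ℝ), x = b + L (0, y₀) ∧ y₀ ≤ 1 ∧
      (∀ t y : ℝ, b + L (t, y) ∈ D → y ∈ Icc (0:ℝ) 3 ∧ |t| ≤ 12) ∧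
      b + L (0, 0) ∈ D ∧ b + L (1, 1) ∈ D ∧ b + L (-1, 1) ∈ D ∧
      ∀ t : ℝ, |t| ≤ 1 / 2 → b + L (t, 5 / 4) ∈ D := by
  obtain ⟨hc, hk, hi⟩ := hD
  obtain ⟨o, hsym⟩ := exists_forall_three_halves_sub_mem hc hk
  have hoi : o ∈ interior D := by
    obtain ⟨y, hy⟩ := hi
    have := hc.combo_interior_self_mem_interior hy (hsym y (interior_subset hy))
      (a := 1 / 3) (b := 2 / 3) (by norm_num) (by norm_num) (by norm_num)
    convert this using 1
    module
  have ho : o ∈ D := interior_subset hoi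
  obtain ⟨v, r, hv, hr, rfl⟩ : ∃ (v : E2) (r : ℝ), v ≠ 0 ∧ 0 ≤ r ∧ x = o + r • v := by
    by_cases h : x = o
    · obtain ⟨v, hv⟩ := exists_ne (0 : E2)
      exact ⟨v, 0, hv, le_rfl, by simp [h]⟩
    · exact ⟨x - o, 1, sub_ne_zero.mpr h, zero_le_one, by simp⟩
  obtain ⟨s, hs0, hbD, hsmax⟩ := exists_last_mem_ray hk ho hv
  have hbi : o + s • v ∉ interior D := fun h => by
    obtain ⟨r', hr', hmem⟩ := exists_gt_mem_of_mem_interior h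
    exact (hsmax r' hmem).not_gt hr'
  obtain ⟨f, hf⟩ := geometric_hahn_banach_open_point hc.interior isOpen_interior hbi
  have hrs := hsmax r hx
  set b := o + s • v with hb
  have hfD : ∀ z ∈ D, f z ≤ f b := by
    intro z hz
    have hcl : closure (interior D) ⊆ {z | f z ≤ f b} :=
      closure_minimal (fun z hz => (hf z hz).le) (isClosed_le f.continuous continuous_const)
    rw [hc.closure_interior_eq_closure_of_nonempty_interior hi] at hcl
    exact hcl (subset_closure hz)
  have hfo : f o < f b := hf o hoi
  have hs : 0 < s := by
    rcases hs0.eq_or_lt with h | h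
    · rw [hb, ← h, zero_smul, add_zero] at hfo
      exact absurd hfo (lt_irrefl _)
    · exact h
  obtain ⟨u₀, hu₀, hu0⟩ : ∃ u₀ : E2, u₀ ≠ 0 ∧ f u₀ = 0 := by
    have := f.toLinearMap.ker_ne_bot_of_finrank_lt (by simp)
    obtain ⟨u₀, h1, h2⟩ := Submodule.exists_mem_ne_zero_of_ne_bot this
    exact ⟨u₀, h2, h1⟩
  obtain ⟨β, hβ0, hβD, hβmax⟩ := exists_last_mem_ray hk ho hu₀
  have hβ : 0 < β := by
    obtain ⟨r', hr', hmem⟩ := exists_gt_mem_of_mem_interior (o := o) (v := u₀) (s := 0)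
      (by simpa using hoi)
    exact hr'.trans_le (hβmax r' hmem)
  let u := (β / 2) • u₀
  have hfu : f u = 0 := by simp [u, hu0]
  have hu : u ≠ 0 := smul_ne_zero (by positivity) hu₀
  have hu2 : o + (2:ℝ) • u ∈ D := by
    convert hβD using 2
    simp only [u]
    module
  have huτ2 : ∀ τ : ℝ, o + τ • u ∈ D → τ ≤ 2 := by
    intro τ hτ
    have := hβmax (τ * (β / 2)) (by convert hτ using 2; simp only [u]; module)
    nlinarith
  have huτ4 : ∀ τ : ℝ, o + τ • u ∈ D → -4 ≤ τ := by
    intro τ hτ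
    have := huτ2 (-τ / 2) (by convert hsym _ hτ using 1; module)
    linarith
  have hum : o + (-1 : ℝ) • u ∈ D := by
    convert hsym _ hu2 using 1
    module
  have hu1 : ∀ τ : ℝ, |τ| ≤ 1 → o + τ • u ∈ D := by
    intro τ hτ
    rw [abs_le] at hτ
    convert hc hum hu2 (a := (2 - τ) / 3) (b := (τ + 1) / 3) (by linarith) (by linarith) (by ring)
      using 1
    module
  let M : (ℝ × ℝ) →ₗ[ℝ] E2 :=
    (LinearMap.fst ℝ ℝ ℝ).smulRight u + (LinearMap.snd ℝ ℝ ℝ).smulRight (o - b)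
  have hM : ∀ t y : ℝ, M (t, y) = t • u + y • (o - b) := fun t y => by simp [M]
  have hfob : f (o - b) < 0 := by rw [map_sub]; linarith
  have hfl : ∀ t y : ℝ, f (t • u + y • (o - b)) = y * f (o - b) := fun t y => by
    rw [map_add f (t • u), map_smul f t u, map_smul f y (o - b), hfu, smul_zero, zero_add,
      smul_eq_mul]
  have hMinj : Function.Injective M := by
    rw [injective_iff_map_eq_zero]
    rintro ⟨t, y⟩ h
    rw [hM] at h
    have hy : y = 0 := by
      have := congrArg f h
      rw [hfl, map_zero] at this
      exact (mul_eq_zero.mp this).resolve_right hfob.ne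
    rw [hy, zero_smul, add_zero] at h
    rw [hy, (smul_eq_zero.mp h).resolve_right hu]
    rfl
  let L : (ℝ × ℝ) ≃L[ℝ] E2 :=
    (M.linearEquivOfInjective hMinj (by simp)).toContinuousLinearEquiv
  have hL : ∀ t y : ℝ, L (t, y) = t • u + y • (o - b) := hM
  have hfL : ∀ t y : ℝ, f (b + L (t, y)) = f b + y * f (o - b) := by
    intro t y
    rw [hL, map_add f b, hfl]
  have hy0 : ∀ t y : ℝ, b + L (t, y) ∈ D → 0 ≤ y := by
    intro t y h
    have := hfD _ h
    rw [hfL] at this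
    by_contra hneg
    nlinarith
  have h32 : b + L (0, 3 / 2) ∈ D := by
    convert hsym _ hbD using 1
    rw [hL]
    module
  have htop : ∀ t : ℝ, b + L (t, 1) ∈ D → -4 ≤ t ∧ t ≤ 2 := by
    intro t h
    have e : b + L (t, 1) = o + t • u := by rw [hL]; module
    rw [e] at h
    exact ⟨huτ4 t h, huτ2 t h⟩
  have hmid : ∀ t : ℝ, |t| ≤ 1 → b + L (t, 1) ∈ D := by
    intro t h
    convert hu1 t h using 1
    rw [hL]
    module
  have hcomb : ∀ t y t' y' c : ℝ, b + L (t, y) ∈ D → b + L (t', y') ∈ D → 0 ≤ c → c ≤ 1 →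
      b + L (c * t + (1 - c) * t', c * y + (1 - c) * y') ∈ D := by
    intro t y t' y' c h h' hc0 hc1
    convert hc h h' hc0 (by linarith : 0 ≤ 1 - c) (by ring) using 1
    simp only [hL]
    module
  have h00 : b + L (0, 0) ∈ D := by
    convert hbD using 1
    rw [hL]
    module
  refine ⟨b, L, 1 - r / s, ?_, ?_, ?_, h00, hmid 1 (by norm_num), hmid (-1) (by norm_num), ?_⟩
  · rw [hL, hb]
    have : r • v = (r / s) • (s • v) := by rw [smul_smul, div_mul_cancel₀ _ hs.ne']
    rw [this]
    module
  · have := div_nonneg hr hs.le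
    linarith
  · intro t y h
    have hy := hy0 t y h
    have hy3 : y ≤ 3 := by
      have := hy0 (-t / 2) (3 / 2 - y / 2) (by
        convert hsym _ h using 1
        simp only [hL]
        module)
      linarith
    refine ⟨⟨hy, hy3⟩, ?_⟩
    rcases le_total 1 y with h1 | h1
    · have := hcomb t y 0 0 (1 / y) h h00 (by positivity) (by rw [div_le_one] <;> linarith)
      rw [mul_zero, add_zero, add_zero, one_div_mul_cancel (by linarith)] at this
      obtain ⟨h4, h5⟩ := htop _ this
      have e : 1 / y * t = t / y := by ring
      rw [e, le_div_iff₀ (by linarith)] at h4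
      rw [e, div_le_iff₀ (by linarith)] at h5
      exact abs_le.mpr ⟨by linarith, by linarith⟩
    · set c := 1 / 2 / (3 / 2 - y) with hcdef
      have hpos : 0 < 3 / 2 - y := by linarith
      have hce : c * (3 / 2 - y) = 1 / 2 := div_mul_cancel₀ _ hpos.ne'
      have hc3 : 1 / 3 ≤ c := by rw [hcdef, le_div_iff₀ hpos]; linarith
      have hc1 : c ≤ 1 := by rw [hcdef, div_le_one hpos]; linarith
      have := hcomb t y 0 (3 / 2) c h h32 (by linarith) hc1
      rw [show c * y + (1 - c) * (3 / 2) = 1 by linarith, mul_zero, add_zero] at this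
      obtain ⟨h4, h5⟩ := htop _ this
      refine abs_le.mpr ⟨?_, ?_⟩ <;> by_contra! hh <;> nlinarith
  · intro t ht
    have := hcomb (2 * t) 1 0 (3 / 2) (1 / 2) (hmid _ (by
      rw [abs_mul]; norm_num; linarith)) h32 (by norm_num) (by norm_num)
    convert this using 4 <;> ring

theorem exists_setIntegral_eq_mul_setIntegral_comp (b : E2) (L : (ℝ × ℝ) ≃L[ℝ] E2) :
    ∃ J : ℝ, 0 < J ∧ ∀ (D : Set E2) (F : E2 → ℝ),
      ∫ z in D, F z = J * ∫ w in (fun w => b + L w) ⁻¹' D, F (b + L w) := by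
  have : Measure.IsAddHaarMeasure (volume : Measure (ℝ × ℝ)) :=
    Measure.volume_eq_prod ℝ ℝ ▸ inferInstance
  have : (Measure.map L (volume : Measure (ℝ × ℝ))).IsAddHaarMeasure := L.isAddHaarMeasure_map _
  refine ⟨Measure.addHaarScalarFactor (volume : Measure E2) (Measure.map L volume),
    Measure.addHaarScalarFactor_pos_of_isAddHaarMeasure _ _, fun D F => ?_⟩
  have h := Measure.isAddLeftInvariant_eq_smul (volume : Measure E2) (Measure.map L volume)
  set J := Measure.addHaarScalarFactor (volume : Measure E2) (Measure.map L volume)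
  have hL : MeasurableEmbedding L := L.toHomeomorph.measurableEmbedding
  rw [← (measurePreserving_add_left volume b).setIntegral_preimage_emb
    (measurableEmbedding_addLeft b) F D, h, Measure.restrict_smul, integral_smul_nnreal_measure,
    hL.setIntegral_map]
  rfl

theorem totalDegree_aeval_le {ι κ : Type*} (p : MvPolynomial ι ℝ) {g : ι → MvPolynomial κ ℝ}
    (hg : ∀ i, (g i).totalDegree ≤ 1) : (MvPolynomial.aeval g p).totalDegree ≤ p.totalDegree := by
  rw [MvPolynomial.aeval_def, MvPolynomial.eval₂]
  refine (MvPolynomial.totalDegree_finsetSum _ _).trans (Finset.sup_le fun d hd => ?_)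
  refine (MvPolynomial.totalDegree_mul _ _).trans ?_
  rw [MvPolynomial.algebraMap_eq, MvPolynomial.totalDegree_C, zero_add]
  refine (MvPolynomial.totalDegree_finsetProd _ _).trans
    (le_trans (Finset.sum_le_sum fun i _ => ?_) (MvPolynomial.le_totalDegree hd))
  exact (MvPolynomial.totalDegree_pow _ _).trans (by nlinarith [hg i])

theorem eval_aeval_mvPolynomial_pair (p g₀ g₁ : MvPolynomial (Fin 2) ℝ) (v : Fin 2 → ℝ) :
    MvPolynomial.eval v (MvPolynomial.aeval ![g₀, g₁] p) =
      MvPolynomial.eval ![MvPolynomial.eval v g₀, MvPolynomial.eval v g₁] p := by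
  rw [MvPolynomial.map_aeval ![g₀, g₁] (MvPolynomial.eval v) p, MvPolynomial.eval]
  congr 2
  · ext; simp
  · ext i; fin_cases i <;> simp

theorem exists_mvPolynomial_setIntegral_le_setIntegral {D : Set E2} (hD : IsConvexBody D) {x : E2}
    (hx : x ∈ D) {n : ℕ} (hn : 1 ≤ n) (p : MvPolynomial (Fin 2) ℝ) (hp : p.totalDegree ≤ 2 * n)
    (hpx : MvPolynomial.eval (fun i => x i) p = 1) :
    ∃ q : MvPolynomial (Fin 2) ℝ, q.totalDegree ≤ n ∧ MvPolynomial.eval (fun i => x i) q = 1 ∧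
      ∫ z in D, MvPolynomial.eval (fun i => z i) q ^ 2 ≤
        10 ^ 21 * ∫ z in D, MvPolynomial.eval (fun i => z i) p ^ 2 := by
  obtain ⟨b, L, y₀, hxy, hy1, hb, h0, h1, h2, h3⟩ := exists_normal_position hD hx
  obtain ⟨J, hJ, h_int⟩ := exists_setIntegral_eq_mul_setIntegral_comp b L
  set K := (fun w => b + L w) ⁻¹' D with hK
  have hKc : Convex ℝ K := by
    have : K = L.toLinearMap ⁻¹' ((fun z => b + z) ⁻¹' D) := rfl
    rw [this]
    exact (hD.1.translate_preimage_right b).linear_preimage _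
  have hKk : IsCompact K :=
    (L.toHomeomorph.trans (Homeomorph.addLeft b)).isCompact_preimage.mpr hD.2.1
  let l : Fin 2 → MvPolynomial (Fin 2) ℝ := fun i =>
    MvPolynomial.C (L (1, 0) i) * MvPolynomial.X 0 +
      (MvPolynomial.C (L (0, 1) i) * MvPolynomial.X 1 + MvPolynomial.C (b i))
  have hl : ∀ i t y, MvPolynomial.eval ![t, y] (l i) = (b + L (t, y)) i := by
    intro i t y
    have : ((t, y) : ℝ × ℝ) = t • (1, 0) + y • (0, 1) := by simp
    rw [this, map_add L, map_smul L, map_smul L]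
    simp [l]
    ring
  let p' := MvPolynomial.aeval ![l 0, l 1] p
  have hp' : ∀ t y, MvPolynomial.eval ![t, y] p' =
      MvPolynomial.eval (fun i => (b + L (t, y)) i) p := by
    intro t y
    rw [eval_aeval_mvPolynomial_pair, hl, hl]
    congr 2
    ext i
    fin_cases i <;> rfl
  have hp'd : p'.totalDegree ≤ 2 * n :=
    (totalDegree_aeval_le p (Fin.forall_fin_two.mpr
      ⟨totalDegree_linear_le _ _ _ _ _, totalDegree_linear_le _ _ _ _ _⟩)).trans hp
  obtain ⟨q, hqd, hq1, hq⟩ := exists_mvPolynomial_mul_setIntegral_le hKc hKk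
    (fun z hz => hb z.1 z.2 hz) h0 h1 h2 h3 hn hy1 (show b + L (0, y₀) ∈ D from hxy ▸ hx) p' hp'd
  let φ : (ℝ × ℝ →ₗ[ℝ] ℝ) → MvPolynomial (Fin 2) ℝ := fun π =>
    MvPolynomial.C (π (L.symm (EuclideanSpace.single 0 1))) * MvPolynomial.X 0 +
      (MvPolynomial.C (π (L.symm (EuclideanSpace.single 1 1))) * MvPolynomial.X 1 +
        MvPolynomial.C (-π (L.symm b)))
  have hφ : ∀ π w, MvPolynomial.eval (fun i => (b + L w) i) (φ π) = π w := by
    intro π w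
    have hz : ∀ z : E2, z = z 0 • EuclideanSpace.single 0 1 + z 1 • EuclideanSpace.single 1 1 := by
      intro z
      ext i
      fin_cases i <;> simp
    have e : w = L.symm (b + L w) - L.symm b := by simp
    conv_rhs => rw [e, hz (b + L w)]
    rw [map_sub π, map_add L.symm, map_smul L.symm, map_smul L.symm, map_add π, map_smul π,
      map_smul π]
    simp only [φ, map_add, map_mul, MvPolynomial.eval_C, MvPolynomial.eval_X, smul_eq_mul]
    ring
  let q' := MvPolynomial.aeval ![φ (LinearMap.fst ℝ ℝ ℝ), φ (LinearMap.snd ℝ ℝ ℝ)] q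
  have hq' : ∀ w, MvPolynomial.eval (fun i => (b + L w) i) q' =
      MvPolynomial.eval ![w.1, w.2] q := by
    intro w
    rw [eval_aeval_mvPolynomial_pair, hφ, hφ]
    rfl
  have hφd : ∀ π, (φ π).totalDegree ≤ 1 := fun π => totalDegree_linear_le _ _ _ _ _
  have hq'd : q'.totalDegree ≤ n :=
    (totalDegree_aeval_le q (Fin.forall_fin_two.mpr ⟨hφd _, hφd _⟩)).trans hqd
  clear_value q' p' φ
  refine ⟨q', hq'd, ?_, ?_⟩
  · rw [hxy, hq', hq1]
  · rw [h_int, h_int]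
    simp only [hq']
    rw [hp', ← hxy, hpx, one_pow, one_mul] at hq
    simp only [hp'] at hq
    rw [mul_left_comm]
    exact mul_le_mul_of_nonneg_left hq hJ.le

theorem christoffel_bddBelow (d n : ℕ) (x : E d) (D : Set (E d)) :
    BddBelow { r : ℝ | ∃ p : MvPolynomial (Fin d) ℝ, p.totalDegree ≤ n ∧
      MvPolynomial.eval (fun i => x i) p = 1 ∧
      r = ∫ y in D, (MvPolynomial.eval (fun i => y i) p) ^ 2 } := by
  refine ⟨0, ?_⟩
  rintro _ ⟨p, -, -, rfl⟩
  exact integral_nonneg fun _ => sq_nonneg _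

theorem christoffel_le {d n : ℕ} {x : E d} (D : Set (E d)) {p : MvPolynomial (Fin d) ℝ}
    (hp : p.totalDegree ≤ n) (hpx : MvPolynomial.eval (fun i => x i) p = 1) :
    christoffel d n x D ≤ ∫ y in D, (MvPolynomial.eval (fun i => y i) p) ^ 2 :=
  csInf_le (christoffel_bddBelow d n x D) ⟨p, hp, hpx, rfl⟩

theorem le_christoffel {d n : ℕ} {x : E d} {D : Set (E d)} {a : ℝ}
    (h : ∀ p : MvPolynomial (Fin d) ℝ, p.totalDegree ≤ n →
      MvPolynomial.eval (fun i => x i) p = 1 →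
      a ≤ ∫ y in D, (MvPolynomial.eval (fun i => y i) p) ^ 2) : a ≤ christoffel d n x D := by
  refine le_csInf ⟨_, 1, by simp, by simp, rfl⟩ ?_
  rintro _ ⟨p, hp, hpx, rfl⟩
  exact h p hp hpx

/-- Corollary 3.4: `λ_{2n}(x,D) ≈ λ_n(x,D)` for planar convex bodies. -/
theorem stmt4 : ∃ c : ℝ, 1 ≤ c ∧ ∀ D : Set E2, IsConvexBody D → ∀ x ∈ D, ∀ n : ℕ, 1 ≤ n →
    c⁻¹ * christoffel 2 n x D ≤ christoffel 2 (2 * n) x D ∧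
    christoffel 2 (2 * n) x D ≤ c * christoffel 2 n x D := by
  refine ⟨10 ^ 21, by norm_num, fun D hD x hx n hn => ⟨?_, ?_⟩⟩
  · refine le_christoffel fun p hp hpx => ?_
    obtain ⟨q, hqd, hqx, hq⟩ := exists_mvPolynomial_setIntegral_le_setIntegral hD hx hn p hp hpx
    rw [inv_mul_le_iff₀ (by norm_num)]
    exact (christoffel_le D hqd hqx).trans hq
  · have h0 : 0 ≤ christoffel 2 n x D :=
      le_christoffel fun p _ _ => integral_nonneg fun _ => sq_nonneg _
    have h1 : christoffel 2 (2 * n) x D ≤ christoffel 2 n x D :=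
      le_christoffel fun p hp hpx => christoffel_le D (hp.trans (by omega)) hpx
    linarith
end
end

section
/- There exists an absolute constant c ≥ 1 such that for every convex body D ⊆ ℝ² with 0 ∈ D, every integer n ≥ 1, every x ∈ D and every μ ∈ [1 − 2⁻⁴n⁻², 1]: c⁻¹·λₙ(μ·x, D) ≤ λₙ(x,D) ≤ c·λₙ(μ·x, D). -/
open MeasureTheory Set Pointwise

noncomputable section

/-- A polynomial of degree at most `m` with values in `[0, M]` on `[0, 1]` is at most
`cosh (m * a) * M` at `t ≥ 1`, where `a ^ 2 = 4 * (t - 1)`. -/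
theorem Polynomial.eval_le_cosh_mul_of_mem_Icc {F : Polynomial ℝ} {m : ℕ} (hdeg : F.natDegree ≤ m)
    {M : ℝ} (hF : ∀ t ∈ Icc (0:ℝ) 1, F.eval t ∈ Icc 0 M) {t a : ℝ} (ht : 1 ≤ t) (ha : 0 ≤ a)
    (hta : 4 * (t - 1) ≤ a ^ 2) : F.eval t ≤ Real.cosh (m * a) * M := by
  have hT : ((Polynomial.Chebyshev.T ℝ m).eval (2 * t - 1)) ≤ Real.cosh (m * a) := by
    have h1 : (1:ℝ) ≤ 2 * t - 1 := by linarith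
    set b := Real.arcosh (2 * t - 1) with hb
    have hb0 : 0 ≤ b := Real.arcosh_nonneg h1
    have hcosh : Real.cosh b = 2 * t - 1 := Real.cosh_arcosh h1
    have hb2 : b ^ 2 ≤ a ^ 2 := by
      have h2 : Real.cosh b = 1 + 2 * Real.sinh (b / 2) ^ 2 := by
        have := Real.cosh_two_mul (b / 2)
        rw [mul_div_cancel₀ _ two_ne_zero, Real.cosh_sq] at this
        linarith
      have h3 : b / 2 ≤ Real.sinh (b / 2) := Real.self_le_sinh_iff.2 (by positivity)
      have h4 : (b / 2) ^ 2 ≤ Real.sinh (b / 2) ^ 2 := by gcongr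
      nlinarith
    have hba : b ≤ a := abs_le_of_sq_le_sq' hb2 ha |>.2
    rw [← hcosh, Polynomial.Chebyshev.T_real_cosh, Real.cosh_le_cosh, Int.cast_natCast,
      abs_of_nonneg (by positivity), abs_of_nonneg (by positivity)]
    gcongr
  have hM : 0 ≤ M := (hF 0 (by simp)).1.trans (hF 0 (by simp)).2
  -- Allow an arbitrarily larger bound, so that one can divide by it.
  refine le_of_forall_pos_le_add fun ε hε => ?_
  set C := Real.cosh (m * a) with hC
  have hC1 : 0 < C := Real.cosh_pos _
  set N := M + ε / C with hN
  have hN0 : 0 < N := by positivity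
  let P : Polynomial ℝ := Polynomial.C N⁻¹ *
    F.comp (Polynomial.C 2⁻¹ * Polynomial.X + Polynomial.C 2⁻¹)
  have hPeval (s : ℝ) : P.eval s = N⁻¹ * F.eval (2⁻¹ * s + 2⁻¹) := by simp [P]
  have hPdeg : P.degree ≤ m := by
    refine Polynomial.natDegree_le_iff_degree_le.1 ?_
    refine (Polynomial.natDegree_C_mul_le _ _).trans (Polynomial.natDegree_comp_le.trans ?_)
    calc _ ≤ F.natDegree * 1 := Nat.mul_le_mul_left _ Polynomial.natDegree_linear_le
      _ ≤ m := by simpa using hdeg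
  have hPb : ∀ s ∈ Icc (-1:ℝ) 1, |P.eval s| ≤ 1 := by
    intro s hs
    have h := hF (2⁻¹ * s + 2⁻¹) ⟨by linarith [hs.1], by linarith [hs.2]⟩
    have hMN : M ≤ N := by rw [hN]; linarith [div_pos hε hC1]
    rw [hPeval, abs_of_nonneg (mul_nonneg (by positivity) h.1), inv_mul_le_one₀ hN0]
    exact h.2.trans hMN
  have h := Polynomial.Chebyshev.eval_iterate_derivative_le_of_forall_abs_le_one (k := 0)
    (show 1 ≤ 2 * t - 1 by linarith) hPdeg hPb
  simp only [Function.iterate_zero, id] at h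
  rw [hPeval, show 2⁻¹ * (2 * t - 1) + 2⁻¹ = t by ring, inv_mul_le_iff₀ hN0] at h
  calc F.eval t ≤ N * C := h.trans (by gcongr)
    _ = C * M + ε := by rw [hN]; field_simp

/-- The polynomial `y ↦ p (t * y)`. -/
theorem MvPolynomial.exists_eval_mul_eq {σ : Type*} [Fintype σ] (p : MvPolynomial σ ℝ) (t : ℝ) :
    ∃ q : MvPolynomial σ ℝ, q.totalDegree ≤ p.totalDegree ∧
      ∀ y : σ → ℝ, eval y q = eval (fun i => t * y i) p := by
  refine ⟨∑ d ∈ p.support, monomial d (p.coeff d * ∏ i, t ^ d i), ?_, fun y => ?_⟩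
  · refine totalDegree_finsetSum_le fun d hd => ?_
    exact (totalDegree_monomial_le _ _).trans (le_totalDegree hd)
  · rw [map_sum, eval_eq']
    refine Finset.sum_congr rfl fun d _ => ?_
    simp only [eval_monomial, mul_pow, Finset.prod_mul_distrib]
    rw [Finsupp.prod_fintype _ _ (by simp)]
    ring

theorem continuous_eval_mul {d : ℕ} (p : MvPolynomial (Fin d) ℝ) (t : ℝ) :
    Continuous fun y : E d => MvPolynomial.eval (fun i => t * y i) p :=
  p.continuous_eval.comp (by fun_prop)

theorem exists_polynomial_setIntegral_eval_mul {d : ℕ} {D : Set (E d)} (hD : IsCompact D)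
    (p : MvPolynomial (Fin d) ℝ) : ∃ Q : Polynomial ℝ, Q.natDegree ≤ p.totalDegree ∧
      ∀ t : ℝ, Q.eval t = ∫ y in D, MvPolynomial.eval (fun i => t * y i) p := by
  refine ⟨∑ k ∈ p.support, Polynomial.C (∫ y in D, p.coeff k * ∏ i, y i ^ k i) *
    Polynomial.X ^ (∑ i, k i), ?_, fun t => ?_⟩
  · refine Polynomial.natDegree_sum_le_of_forall_le _ _ fun k hk => ?_
    refine (Polynomial.natDegree_C_mul_X_pow_le _ _).trans ?_
    have := MvPolynomial.le_totalDegree hk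
    rwa [Finsupp.sum_fintype _ _ (by simp)] at this
  · simp only [MvPolynomial.eval_eq', Polynomial.eval_finsetSum, Polynomial.eval_mul,
      Polynomial.eval_C, Polynomial.eval_pow, Polynomial.eval_X, mul_pow, Finset.prod_mul_distrib,
      Finset.prod_pow_eq_pow_sum]
    rw [integral_finsetSum]
    · refine Finset.sum_congr rfl fun k _ => ?_
      rw [← integral_mul_const]
      congr 1 with y
      ring
    · intro k _
      exact (by fun_prop : Continuous _).continuousOn.integrableOn_compact hD

theorem setIntegral_eval_mul {d : ℕ} (D : Set (E d)) (p : MvPolynomial (Fin d) ℝ) {t : ℝ}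
    (ht : 0 < t) : t ^ d * ∫ y in D, MvPolynomial.eval (fun i => t * y i) p =
      ∫ y in t • D, MvPolynomial.eval (fun i => y i) p := by
  have h := Measure.setIntegral_comp_smul_of_pos volume
    (fun y : E d => MvPolynomial.eval (fun i => y i) p) D ht
  simp only [PiLp.smul_apply, smul_eq_mul, finrank_euclideanSpace, Fintype.card_fin] at h
  rw [h, ← mul_assoc, mul_inv_cancel₀ (by positivity), one_mul]

/-- The integral of a squared polynomial over `t • D` is monotone in `t`. -/
theorem pow_mul_setIntegral_eval_mul_sq_le {d : ℕ} {D : Set (E d)} (hc : Convex ℝ D)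
    (hD : IsCompact D) (h0 : (0 : E d) ∈ D) (p : MvPolynomial (Fin d) ℝ) {t : ℝ}
    (ht : 0 < t) (ht1 : t ≤ 1) :
    t ^ d * ∫ y in D, MvPolynomial.eval (fun i => t * y i) p ^ 2 ≤
      ∫ y in D, MvPolynomial.eval (fun i => y i) p ^ 2 := by
  simp only [← map_pow]
  rw [setIntegral_eval_mul D _ ht]
  refine setIntegral_mono_set ?_ (ae_of_all _ fun y => ?_) (LE.le.eventuallyLE ?_)
  · have := continuous_eval_mul (p ^ 2) 1
    simp only [one_mul] at this
    exact this.continuousOn.integrableOn_compact hD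
  · simp only [map_pow, Pi.zero_apply]
    positivity
  · rintro _ ⟨y, hy, rfl⟩
    exact hc.smul_mem_of_zero_mem h0 hy ⟨ht.le, ht1⟩

/-- If composition with the dilation by `t` multiplies `L²` norms of polynomials on `D` by a bounded
factor, then Christoffel functions at `x` and `t • x` compare accordingly. -/
theorem christoffel_le_mul_christoffel_smul {d n : ℕ} {D : Set (E d)} {c t : ℝ} (hc : 0 < c)
    (h : ∀ p : MvPolynomial (Fin d) ℝ, p.totalDegree ≤ n →
      ∫ y in D, MvPolynomial.eval (fun i => t * y i) p ^ 2 ≤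
        c * ∫ y in D, MvPolynomial.eval (fun i => y i) p ^ 2) (x : E d) :
    christoffel d n x D ≤ c * christoffel d n (t • x) D := by
  rw [← div_le_iff₀' hc]
  refine le_csInf ⟨_, 1, by simp, by simp, rfl⟩ ?_
  rintro r ⟨p, hp, hpx, rfl⟩
  rw [div_le_iff₀' hc]
  obtain ⟨q, hq, hqe⟩ := p.exists_eval_mul_eq t
  have hqx : MvPolynomial.eval (fun i => x i) q = 1 := by
    rw [hqe]
    exact hpx
  refine le_trans (csInf_le ?_ ⟨q, hq.trans hp, hqx, rfl⟩) ?_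
  · refine ⟨0, ?_⟩
    rintro _ ⟨p, -, -, rfl⟩
    exact integral_nonneg fun y => sq_nonneg _
  · simp only [hqe]
    exact h p hp

/-- Integrals of squared polynomials over `t • D` do not grow much when `t` is close to `1`. -/
theorem setIntegral_eval_mul_sq_le_cosh_mul {d n : ℕ} {D : Set (E d)} (hc : Convex ℝ D)
    (hD : IsCompact D) (h0 : (0 : E d) ∈ D) (hd : 0 < d) {p : MvPolynomial (Fin d) ℝ}
    (hp : p.totalDegree ≤ n) {t a : ℝ} (ht : 1 ≤ t) (ha : 0 ≤ a) (hta : 4 * (t - 1) ≤ a ^ 2) :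
    ∫ y in D, MvPolynomial.eval (fun i => t * y i) p ^ 2 ≤
      Real.cosh ((2 * n + d : ℕ) * a) * ∫ y in D, MvPolynomial.eval (fun i => y i) p ^ 2 := by
  obtain ⟨Q, hQ, hQe⟩ := exists_polynomial_setIntegral_eval_mul hD (p ^ 2)
  simp only [map_pow] at hQe
  have hQ0 (s : ℝ) : 0 ≤ Q.eval s := hQe s ▸ integral_nonneg fun y => sq_nonneg _
  have hdeg : (Q * Polynomial.X ^ d).natDegree ≤ 2 * n + d := by
    refine Polynomial.natDegree_mul_le.trans (add_le_add ?_ (Polynomial.natDegree_X_pow_le d))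
    exact (hQ.trans (MvPolynomial.totalDegree_pow p 2)).trans (by lia)
  have hF := Polynomial.eval_le_cosh_mul_of_mem_Icc hdeg
    (M := ∫ y in D, MvPolynomial.eval (fun i => y i) p ^ 2) (fun s hs => ?_) ht ha hta
  · rw [← hQe]
    refine le_trans ?_ hF
    simp only [Polynomial.eval_mul, Polynomial.eval_pow, Polynomial.eval_X]
    exact le_mul_of_one_le_right (hQ0 t) (one_le_pow₀ ht)
  · simp only [Polynomial.eval_mul, Polynomial.eval_pow, Polynomial.eval_X]
    refine ⟨mul_nonneg (hQ0 s) (pow_nonneg hs.1 d), ?_⟩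
    rcases hs.1.eq_or_lt with rfl | hs0
    · rw [zero_pow hd.ne', mul_zero]
      exact integral_nonneg fun y => sq_nonneg _
    · rw [hQe, mul_comm]
      exact pow_mul_setIntegral_eval_mul_sq_le hc hD h0 p hs0 hs.2

/-- Lemma 3.3: small moves towards the origin do not change the Christoffel function. -/
theorem stmt5 : ∃ c : ℝ, 1 ≤ c ∧ ∀ D : Set E2, IsConvexBody D → (0:E2) ∈ D →
    ∀ n : ℕ, 1 ≤ n → ∀ x ∈ D, ∀ μ ∈ Icc (1 - (16 * (n:ℝ)^2)⁻¹) 1,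
    c⁻¹ * christoffel 2 n (μ • x) D ≤ christoffel 2 n x D ∧
    christoffel 2 n x D ≤ c * christoffel 2 n (μ • x) D := by
  have hc1 : 1 ≤ Real.cosh 4 := Real.one_le_cosh 4
  refine ⟨2 * Real.cosh 4, by linarith, ?_⟩
  rintro D ⟨hc, hD, -⟩ h0 n hn x - μ ⟨hμ, hμ1⟩
  have hn1 : (1:ℝ) ≤ n := by exact_mod_cast hn
  have hn2 : (1:ℝ) ≤ (n:ℝ) ^ 2 := one_le_pow₀ hn1
  have hμ2 : 15 / 16 ≤ μ := by
    have : (16 * (n:ℝ) ^ 2)⁻¹ ≤ 16⁻¹ := inv_anti₀ (by norm_num) (by linarith)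
    linarith
  have hμ0 : 0 < μ := by linarith
  constructor
  · rw [inv_mul_le_iff₀ (by positivity)]
    have h := christoffel_le_mul_christoffel_smul (d := 2) (n := n) (D := D) (t := μ⁻¹)
      (c := 2 * Real.cosh 4) (by positivity) (fun p hp => ?_) (μ • x)
    · rwa [inv_smul_smul₀ hμ0.ne'] at h
    · have hta : 4 * (μ⁻¹ - 1) ≤ (1 / (n:ℝ)) ^ 2 := by
        have h1 : 1 - μ ≤ 1 / (16 * (n:ℝ) ^ 2) := by rw [one_div]; linarith
        have h2 : μ⁻¹ - 1 = (1 - μ) * μ⁻¹ := by field_simp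
        have h3 : μ⁻¹ ≤ 2 := inv_le_of_inv_le₀ (by norm_num) (by linarith)
        have h4 : (1 - μ) * μ⁻¹ ≤ 1 / (16 * (n:ℝ) ^ 2) * 2 :=
          mul_le_mul h1 h3 (by positivity) (by positivity)
        have h5 : (1 / (n:ℝ)) ^ 2 = 8 * (1 / (16 * (n:ℝ) ^ 2) * 2) := by field_simp; norm_num
        have h6 : 0 ≤ 1 / (16 * (n:ℝ) ^ 2) * 2 := by positivity
        rw [h2, h5]
        linarith
      refine (setIntegral_eval_mul_sq_le_cosh_mul hc hD h0 two_pos hp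
        ((one_le_inv₀ hμ0).2 hμ1) (by positivity) hta).trans ?_
      have hcosh : Real.cosh ((2 * n + 2 : ℕ) * (1 / (n:ℝ))) ≤ Real.cosh 4 := by
        rw [Real.cosh_le_cosh, abs_of_nonneg (by positivity), abs_of_nonneg (by positivity),
          mul_one_div, div_le_iff₀ (by positivity)]
        push_cast
        linarith
      refine mul_le_mul_of_nonneg_right ?_ (integral_nonneg fun y => sq_nonneg _)
      linarith
  · refine christoffel_le_mul_christoffel_smul (by positivity) (fun p _ => ?_) x
    have h := pow_mul_setIntegral_eval_mul_sq_le hc hD h0 p hμ0 hμ1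
    have h1 : 0 ≤ ∫ y : E 2 in D, MvPolynomial.eval (fun i => μ * y i) p ^ 2 :=
      integral_nonneg fun y => sq_nonneg _
    have h2 : 1 / 2 ≤ μ ^ 2 := by nlinarith
    have h3 := mul_le_mul_of_nonneg_right h2 h1
    have h4 : 0 ≤ ∫ y : E 2 in D, MvPolynomial.eval (fun i => y i) p ^ 2 :=
      integral_nonneg fun y => sq_nonneg _
    have h5 := mul_le_mul_of_nonneg_right hc1 h4
    linarith
end
end
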